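/- Let p be an odd prime, r ∈ Z, s ∈ N with s < p, and f ∈ Z_p[x] a polynomial with no multiple root and 1 ≤ deg(f) < p. Define R = { n : 0 ≤ n ≤ p−1, gcd(f(n), p) = 1, and there exists h ∈ {r, r+1, …, r+s−1} with h·f(n) ≡ 1 (mod p) } ⊆ Z_p. Then |R| = s + O( deg(f)·p^{1/2}·log p ), and for every positive integer k < p/(2 deg(f)) one has C_k(R, p) ≤ c·deg(f)·p^{1/2}·(log p)^{k+1} for an absolute constant c > 0. -/

import Mathlib

open Finset Filter

/-- The function `f_R` from the paper: `1 - |R|/q` on `R`, `-|R|/q` off `R`. -/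
noncomputable def fsub (q : ℕ) (R : Finset ℕ) (n : ℕ) : ℝ :=
  if n % q ∈ R then 1 - (R.card : ℝ) / q else -((R.card : ℝ) / q)

/-- The correlation measure `C_k(R,q)` of order `k` of a subset `R ⊆ Z_q`. -/
noncomputable def corrK (R : Finset ℕ) (q k : ℕ) : ℝ :=
  sSup {x : ℝ | ∃ (M : ℕ) (d : Fin k → ℕ), 1 ≤ M ∧ M ≤ q ∧ StrictMono d ∧
    (∀ i, d i ≤ q - 1) ∧ x = |∑ n ∈ Finset.range M, ∏ i, fsub q R (n + d i)|}

/-- `C(R,q,s) = max_{1 ≤ k ≤ s} C_k(R,q)`. -/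
noncomputable def corrMeasure (R : Finset ℕ) (q s : ℕ) : ℝ :=
  sSup {x : ℝ | ∃ k, 1 ≤ k ∧ k ≤ s ∧ x = corrK R q k}


section

open Polynomial

/-- Coordinates of `Z ^ B` in the basis `1, Z, …, Z ^ (p - 1)` modulo `Z ^ p = U * Z + V`. -/
noncomputable def powCoord {F : Type*} [Field F] (p : ℕ) (U V : F[X]) : ℕ → ℕ → F[X]
  | 0, j => if j = 0 then 1 else 0
  | B + 1, j =>
    if j = 0 then V * powCoord p U V B (p - 1)
    else if j = 1 then powCoord p U V B 0 + U * powCoord p U V B (p - 1)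
    else powCoord p U V B (j - 1)

theorem weight_injective {p d i j i' j' : ℕ} (hp : 2 ≤ p) (hpd : p.Coprime d) (hj : j < p)
    (hj' : j' < p) (h : p * i + d * j = p * i' + d * j') : i = i' ∧ j = j' := by
  have h1 : d * j ≡ d * j' [MOD p] := by
    have := congrArg (· % p) h
    simpa [Nat.ModEq] using this
  have h2 : j = j' := by
    have := Nat.ModEq.cancel_left_of_coprime hpd h1
    rwa [Nat.ModEq, Nat.mod_eq_of_lt hj, Nat.mod_eq_of_lt hj'] at this
  subst h2
  exact ⟨Nat.eq_of_mul_eq_mul_left (by omega) (Nat.add_right_cancel h), rfl⟩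

theorem stepanov_dimension_count {p d t α s : ℕ} (hp : 3 ≤ p) (hd : 1 ≤ d)
    (htd : d * (d + 1) ≤ t) (hα : t = d + 1 + α) (hs : s = p * t) :
    s * (s - p - d) + (s + 2 * d * p - d) + 1 < (α + 1) * p * ((t + d + 1) * p) := by
  have e1 : p * (p * (d * (d + 1))) ≤ p * s := by rw [hs]; gcongr
  have h2 : 2 * d ≤ t := le_trans (by nlinarith) htd
  have e3 : 2 * d * p ≤ s := by rw [hs, mul_comm]; gcongr
  have h3 : 3 * d ≤ d * p := by rw [mul_comm]; gcongr
  have e4 : s * 3 ≤ s * (p + d - 1) := Nat.mul_le_mul_left _ (by omega)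
  have h5 : p + d ≤ s := by nlinarith
  obtain ⟨e, rfl⟩ := Nat.exists_eq_add_of_le h5
  rw [show p + d + e - p - d = e by omega]
  zify [show d ≤ p + d + e + 2 * d * p by omega, show 1 ≤ p + d by omega] at *
  have h7 : (α : ℤ) = t - d - 1 := by linarith
  have h6 : (e : ℤ) = p * t - p - d := by linarith
  rw [h7, h6]
  rw [h6] at e1 e3 e4
  have h8 : (3 : ℤ) * 1 ≤ p * t := by gcongr; linarith
  linarith

section Stepanov

variable {F : Type*} [Field F] {p : ℕ} {U V : F[X]} {d : ℕ}

theorem pow_eq_sum_powCoord (hp : 2 ≤ p) {x z : F} (hz : z ^ p = U.eval x * z + V.eval x) (B : ℕ) :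
    z ^ B = ∑ j ∈ Finset.range p, (powCoord p U V B j).eval x * z ^ j := by
  obtain ⟨n, rfl⟩ := Nat.exists_eq_add_of_le' hp
  induction B with
  | zero =>
    rw [Finset.sum_eq_single 0] <;> simp +contextual [powCoord]
  | succ B ih =>
    rw [pow_succ, ih, Finset.sum_range_succ, Finset.sum_range_succ', Finset.sum_range_succ',
      Finset.sum_range_succ']
    simp only [powCoord, Nat.add_eq_zero_iff, one_ne_zero, and_false, if_false, if_true,
      Nat.add_sub_cancel, add_eq_right, eval_mul, eval_add, add_mul, Finset.sum_mul, pow_zero,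
      mul_one, zero_add, pow_one, show n + 2 - 1 = n + 1 by omega]
    have h1 : ∀ a : F, a * z ^ (n + 1) * z = a * z ^ (n + 2) := fun a => by ring
    rw [h1, hz]
    have h2 : ∀ k, (powCoord (n + 2) U V B (k + 1)).eval x * z ^ (k + 1) * z =
      (powCoord (n + 2) U V B (k + 1)).eval x * z ^ (k + 1 + 1) := fun a => by ring
    simp only [h2]
    ring

theorem weight_powCoord_le (hp : 2 ≤ p) (hV : V.natDegree = d) (hU : p * U.natDegree < (p - 1) * d)
    (B : ℕ) : ∀ j < p, ∀ i, (powCoord p U V B j).coeff i ≠ 0 → p * i + d * j ≤ d * B := by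
  have hd : p * d = (p - 1) * d + d := by
    obtain ⟨n, rfl⟩ := Nat.exists_eq_add_of_le' hp
    simp; ring
  have hcomm : d * (p - 1) = (p - 1) * d := mul_comm _ _
  induction B with
  | zero =>
    intro j _ i h
    by_cases hj : j = 0
    · subst hj
      simp only [powCoord, if_true, coeff_one, ne_eq, ite_eq_right_iff, one_ne_zero] at h
      have : i = 0 := by tauto
      simp [this]
    · simp [powCoord, hj] at h
  | succ B ih =>
    have key : ∀ (G : F[X]) (i : ℕ), (G * powCoord p U V B (p - 1)).coeff i ≠ 0 →
        p * i + d * (p - 1) ≤ p * G.natDegree + d * B := by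
      intro G i h
      rw [coeff_mul] at h
      obtain ⟨⟨a, b⟩, hab, h'⟩ := Finset.exists_ne_zero_of_sum_ne_zero h
      have h1 : a ≤ _ := le_natDegree_of_ne_zero (left_ne_zero_of_mul h')
      have h2 := ih (p - 1) (by omega) b (right_ne_zero_of_mul h')
      rw [Finset.HasAntidiagonal.mem_antidiagonal] at hab
      subst hab
      have := Nat.mul_le_mul_left p h1
      rw [mul_add]
      dsimp only at *
      omega
    intro j hj i h
    rw [mul_add, mul_one]
    by_cases h0 : j = 0
    · subst h0
      simp only [powCoord, if_true] at h
      have := key V i h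
      rw [hV] at this
      simp only [mul_zero]
      omega
    by_cases h1 : j = 1
    · subst h1
      simp only [powCoord, one_ne_zero, if_false, if_true, coeff_add] at h
      by_cases h2 : (powCoord p U V B 0).coeff i = 0
      · rw [h2, zero_add] at h
        have := key U i h
        omega
      · have := ih 0 (by omega) i h2
        omega
    · simp only [powCoord, h0, h1, if_false] at h
      have := ih (j - 1) (by omega) i h
      have h3 : d * j = d * (j - 1) + d := by
        obtain ⟨k, rfl⟩ := Nat.exists_eq_succ_of_ne_zero h0
        simp; ring
      omega

theorem coeff_powCoord_ne_zero (hp : 3 ≤ p) (hV : V.natDegree = d) (hV0 : V ≠ 0)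
    (hU : p * U.natDegree < (p - 1) * d) (B : ℕ) :
    (powCoord p U V B (B % p)).coeff (d * (B / p)) ≠ 0 := by
  have hd : p * d = (p - 1) * d + d := by
    obtain ⟨n, rfl⟩ := Nat.exists_eq_add_of_le' hp
    simp; ring
  have hcomm : d * (p - 1) = (p - 1) * d := mul_comm _ _
  induction B with
  | zero => simp [powCoord]
  | succ B ih =>
    have hw := weight_powCoord_le (by omega) hV hU B
    have hB := Nat.div_add_mod B p
    have hlt := Nat.mod_lt B (show 0 < p by omega)
    by_cases hc : B % p = p - 1
    · have e : B + 1 = p * (B / p + 1) := by rw [mul_add]; omega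
      have e1 : (B + 1) % p = 0 := by rw [e]; simp
      have e2 : (B + 1) / p = B / p + 1 := by rw [e]; exact Nat.mul_div_cancel_left _ (by omega)
      rw [e1, e2]
      simp only [powCoord, if_true]
      rw [mul_add, mul_one, add_comm, coeff_mul_add_eq_of_natDegree_le hV.le]
      · rw [← hV, coeff_natDegree, ← hc, hV]
        exact mul_ne_zero (by simpa using hV0) ih
      · rw [natDegree_le_iff_coeff_eq_zero]
        intro N hN
        by_contra h
        have h1 := hw (p - 1) (by omega) N h
        have : d * B = p * (d * (B / p)) + d * (p - 1) := by
          conv_lhs => rw [← hB, hc]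
          ring
        have := (Nat.mul_lt_mul_left (show 0 < p by omega)).2 hN
        omega
    · have e1 : (B + 1) % p = B % p + 1 := by
        rw [Nat.add_mod, Nat.mod_eq_of_lt (show 1 < p by omega), Nat.mod_eq_of_lt (by omega)]
      have e2 : (B + 1) / p = B / p := by
        rw [Nat.add_div (by omega), Nat.mod_eq_of_lt (show 1 < p by omega), if_neg (by omega),
          Nat.div_eq_of_lt (by omega : 1 < p)]
        simp
      rw [e1, e2]
      by_cases h0 : B % p = 0
      · rw [h0] at ih ⊢
        simp only [powCoord, zero_add, one_ne_zero, if_false, if_true, coeff_add]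
        have : (U * powCoord p U V B (p - 1)).coeff (d * (B / p)) = 0 := by
          rw [coeff_mul]
          apply Finset.sum_eq_zero
          rintro ⟨a, b⟩ hab
          rw [Finset.HasAntidiagonal.mem_antidiagonal] at hab
          by_contra h'
          have h1 : a ≤ _ := le_natDegree_of_ne_zero (left_ne_zero_of_mul h')
          have h2 := hw (p - 1) (by omega) b (right_ne_zero_of_mul h')
          have h3 := Nat.mul_le_mul_left p h1
          have h4 : d * B = p * (a + b) := by
            rw [hab]
            conv_lhs => rw [← hB, h0]
            ring
          rw [mul_add] at h4
          omega
        rwa [this, add_zero]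
      · simpa [powCoord, h0] using ih

/-- Coordinates of `∑ k, c k * X ^ A k * Z ^ B k` modulo `Z ^ p = U * Z + V`. -/
noncomputable def sumCoord {ι : Type*} [Fintype ι] (p : ℕ) (U V : F[X]) (A B : ι → ℕ) (c : ι → F)
    (j : ℕ) : F[X] :=
  ∑ k, C (c k) * (X ^ A k * powCoord p U V (B k) j)

variable {ι : Type*} [Fintype ι] {A B : ι → ℕ} {c : ι → F}

theorem sum_eq_sum_sumCoord (hp : 2 ≤ p) {x z : F} (hz : z ^ p = U.eval x * z + V.eval x) :
    ∑ k, c k * (x ^ A k * z ^ B k) =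
      ∑ j ∈ Finset.range p, (sumCoord p U V A B c j).eval x * z ^ j := by
  simp only [sumCoord, eval_finsetSum, Finset.sum_mul]
  rw [Finset.sum_comm]
  refine Finset.sum_congr rfl fun k _ => ?_
  rw [pow_eq_sum_powCoord hp hz (B k), Finset.mul_sum, Finset.mul_sum]
  refine Finset.sum_congr rfl fun j _ => ?_
  simp only [eval_mul, eval_C, eval_pow, eval_X]
  ring

theorem coeff_X_pow_mul_powCoord {a b i j : ℕ} (hp : 2 ≤ p) (hV : V.natDegree = d)
    (hU : p * U.natDegree < (p - 1) * d) (hj : j < p)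
    (h : (X ^ a * powCoord p U V b j).coeff i ≠ 0) : p * i + d * j ≤ p * a + d * b := by
  rw [coeff_X_pow_mul'] at h
  split_ifs at h with hle
  · have := weight_powCoord_le hp hV hU b j hj _ h
    obtain ⟨e, rfl⟩ := Nat.exists_eq_add_of_le hle
    rw [Nat.add_sub_cancel_left] at this
    rw [mul_add]
    omega
  · exact absurd rfl h

theorem weight_sumCoord_le (hp : 2 ≤ p) (hV : V.natDegree = d)
    (hU : p * U.natDegree < (p - 1) * d) {i j : ℕ} (hj : j < p)
    (h : (sumCoord p U V A B c j).coeff i ≠ 0) :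
    ∃ k, c k ≠ 0 ∧ p * i + d * j ≤ p * A k + d * B k := by
  simp only [sumCoord, finsetSum_coeff, coeff_C_mul] at h
  obtain ⟨k, -, hk⟩ := Finset.exists_ne_zero_of_sum_ne_zero h
  exact ⟨k, left_ne_zero_of_mul hk,
    coeff_X_pow_mul_powCoord hp hV hU hj (right_ne_zero_of_mul hk)⟩

theorem exists_sumCoord_ne_zero (hp : 3 ≤ p) (hV : V.natDegree = d) (hV0 : V ≠ 0)
    (hU : p * U.natDegree < (p - 1) * d)
    (hinj : Function.Injective fun k => p * A k + d * B k) (hc : c ≠ 0) :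
    ∃ j < p, sumCoord p U V A B c j ≠ 0 := by
  classical
  obtain ⟨k₁, hk₁⟩ := Function.ne_iff.1 hc
  obtain ⟨k₀, hk₀, hmax⟩ := Finset.exists_max_image (Finset.univ.filter fun k => c k ≠ 0)
    (fun k => p * A k + d * B k) ⟨k₁, by simpa using hk₁⟩
  have hk₀' : c k₀ ≠ 0 := by simpa using hk₀
  refine ⟨B k₀ % p, Nat.mod_lt _ (by omega), fun h => ?_⟩
  have h' := congrArg (fun G => G.coeff (d * (B k₀ / p) + A k₀)) h
  simp only [sumCoord, finsetSum_coeff, coeff_C_mul, coeff_zero] at h'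
  rw [Finset.sum_eq_single k₀] at h'
  · rw [coeff_X_pow_mul] at h'
    exact mul_ne_zero hk₀' (coeff_powCoord_ne_zero hp hV hV0 hU _) h'
  · intro k _ hk
    by_contra hne
    have h1 := hmax k (by simpa using left_ne_zero_of_mul hne)
    have h2 := coeff_X_pow_mul_powCoord (by omega) hV hU (Nat.mod_lt _ (by omega))
      (right_ne_zero_of_mul hne)
    refine hk (hinj (le_antisymm h1 ?_))
    have h3 : d * B k₀ = p * (d * (B k₀ / p)) + d * (B k₀ % p) := by
      conv_lhs => rw [← Nat.div_add_mod (B k₀) p]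
      ring
    simp only
    rw [mul_add] at h2
    omega
  · simp


theorem exists_sumCoord_eq_zero (hp : 2 ≤ p) (hpd : p.Coprime d) (hV : V.natDegree = d)
    (hU : p * U.natDegree < (p - 1) * d) {W : ℕ} (hW : ∀ k, p * A k + d * B k ≤ W)
    (hcard : W + 1 < Fintype.card ι) :
    ∃ c : ι → F, c ≠ 0 ∧ ∀ j < p, sumCoord p U V A B c j = 0 := by
  classical
  let J := ((Finset.range (W + 1)) ×ˢ (Finset.range p)).filter fun e => p * e.1 + d * e.2 ≤ W
  have hJ : J.card ≤ W + 1 := by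
    rw [← Finset.card_range (W + 1)]
    refine Finset.card_le_card_of_injOn (fun e => p * e.1 + d * e.2) (fun e he => ?_) ?_
    · simp only [J, Finset.coe_filter, Set.mem_ofPred_eq] at he
      simp; omega
    · rintro ⟨i, j⟩ h ⟨i', j'⟩ h' heq
      simp only [J, Finset.coe_filter, Set.mem_ofPred_eq, Finset.mem_product,
        Finset.mem_range] at h h' heq
      have := weight_injective hp hpd h.1.2 h'.1.2 heq
      simp [this]
  let φ : (ι → F) →ₗ[F] (J → F) :=
    { toFun := fun c e => (sumCoord p U V A B c e.1.2).coeff e.1.1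
      map_add' := fun c c' => by
        ext e
        simp [sumCoord, add_mul, Finset.sum_add_distrib]
      map_smul' := fun a c => by
        ext e
        simp [sumCoord, Finset.mul_sum, mul_assoc] }
  have hker : LinearMap.ker φ ≠ ⊥ := by
    apply LinearMap.ker_ne_bot_of_finrank_lt
    simp only [Module.finrank_fintype_fun_eq_card, Fintype.card_coe]
    omega
  obtain ⟨c, hc, hc0⟩ := (Submodule.ne_bot_iff _).1 hker
  refine ⟨c, hc0, fun j hj => ?_⟩
  ext i
  rw [coeff_zero]
  by_contra h
  obtain ⟨k, -, hk⟩ := weight_sumCoord_le hp hV hU hj h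
  have h1 := hW k
  have h2 : i ≤ p * i := Nat.le_mul_of_pos_left _ (by omega)
  have h3 : (i, j) ∈ J := by
    simp only [J, Finset.mem_filter, Finset.mem_product, Finset.mem_range]
    omega
  exact h (congrFun (LinearMap.mem_ker.1 hc) ⟨(i, j), h3⟩)

/-- Stepanov's bound for the number of `x` fixed by the `p ^ (2 * (ν + 1))`-power map all of whose
fibres on the curve `Z ^ p = U * Z + V` are fixed as well. -/
theorem stepanov_card_le [IsAlgClosed F] [Fact p.Prime] [CharP F p] (hp : 3 ≤ p)
    (hpd : p.Coprime d) (hd : 1 ≤ d)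
    (hV : V.natDegree = d) (hU : p * U.natDegree < (p - 1) * d) {t : ℕ} {ν : ℕ}
    (ht : t = p ^ ν) (htd : d * (d + 1) ≤ t) (S : Finset F)
    (hS : ∀ x ∈ S, x ^ (p * t) ^ 2 = x ∧ ∃ Z : Finset F, Z.card = p ∧
      ∀ z ∈ Z, z ^ (p * t) ^ 2 = z ∧ z ^ p = U.eval x * z + V.eval x) :
    p * S.card ≤ (p * t) ^ 2 + (2 * d * p + 1) * (p * t) := by
  classical
  have hV0 : V ≠ 0 := by rintro rfl; simp at hV; omega
  obtain ⟨α, hα⟩ := Nat.exists_eq_add_of_le (show d + 1 ≤ t by nlinarith)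
  set s := p * t with hs
  let ι := (Fin (α + 1) × Fin p) × (Fin (t + d + 1) × Fin p)
  have hl : ∀ (a : Fin (α + 1)) (b : Fin p), p * a + d * b + p + d ≤ s := by
    intro a b
    have h1 : p * a ≤ p * α := Nat.mul_le_mul_left _ (by omega)
    have h2 : d * (b + 1) ≤ d * p := Nat.mul_le_mul_left _ (by omega)
    rw [hs, hα]
    nlinarith
  have hm : ∀ (a : Fin (t + d + 1)) (b : Fin p), p * a + d * b + d ≤ s + 2 * d * p := by
    intro a b
    have h1 : p * a ≤ p * (t + d) := Nat.mul_le_mul_left _ (by omega)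
    have h2 : d * (b + 1) ≤ d * p := Nat.mul_le_mul_left _ (by omega)
    rw [hs]
    nlinarith
  obtain ⟨c', hc'0, hc'⟩ := exists_sumCoord_eq_zero (F := F) (ι := ι) (U := U)
    (A := fun k => s * k.1.1 + k.2.1) (B := fun k => s * k.1.2 + k.2.2)
    (W := s * (s - p - d) + (s + 2 * d * p - d)) (by omega) hpd hV hU (by
      rintro ⟨⟨a, b⟩, ⟨i, j⟩⟩
      have h1 := hl a b
      have h2 := hm i j
      have h3 : s * (p * a + d * b) ≤ s * (s - p - d) := Nat.mul_le_mul_left _ (by omega)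
      simp only
      have : p * (s * a + i) + d * (s * b + j) = s * (p * a + d * b) + (p * i + d * j) := by ring
      omega) (by
      simp only [ι, Fintype.card_prod, Fintype.card_fin]
      exact stepanov_dimension_count hp hd htd hα hs)
  have hsp : s = p ^ (ν + 1) := by rw [hs, ht, pow_succ, mul_comm]
  have hs0 : 0 < s := by rw [hsp]; positivity
  choose c hc using fun k => IsAlgClosed.exists_pow_nat_eq (c' k) hs0
  have hpow : ∀ y : F, y ^ s ^ 2 = y → ∀ a i : ℕ, (y ^ (a + s * i)) ^ s = y ^ (s * a + i) := by
    intro y hy a i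
    rw [← pow_mul, show (a + s * i) * s = s * a + s ^ 2 * i by ring, pow_add, pow_mul y (s ^ 2), hy,
      ← pow_add]
  have hc0 : c ≠ 0 := by
    rintro rfl
    apply hc'0
    ext k
    rw [← hc k]
    simp [hs0.ne']
  obtain ⟨j, hj, hne⟩ := exists_sumCoord_ne_zero (ι := ι) (U := U)
    (A := fun k => k.1.1 + s * k.2.1) (B := fun k => k.1.2 + s * k.2.2) hp hV hV0 hU (by
      rintro ⟨⟨a, b⟩, ⟨i, j⟩⟩ ⟨⟨a', b'⟩, ⟨i', j'⟩⟩ h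
      simp only at h
      have e1 := hl a b
      have e2 := hl a' b'
      have h' : (p * a + d * b) + s * (p * i + d * j) = (p * a' + d * b') + s * (p * i' + d * j') := by
        linarith
      have h1 := congrArg (· % s) h'
      have h2 := congrArg (· / s) h'
      simp only [Nat.add_mul_mod_self_left, Nat.add_mul_div_left _ _ hs0] at h1 h2
      rw [Nat.mod_eq_of_lt (by omega), Nat.mod_eq_of_lt (by omega)] at h1
      rw [Nat.div_eq_of_lt (by omega), Nat.div_eq_of_lt (by omega), zero_add, zero_add] at h2
      have h3 := weight_injective (by omega) hpd b.2 b'.2 h1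
      have h4 := weight_injective (by omega) hpd j.2 j'.2 h2
      exact Prod.ext (Prod.ext (Fin.ext h3.1) (Fin.ext h3.2))
        (Prod.ext (Fin.ext h4.1) (Fin.ext h4.2))) hc0
  set G := sumCoord p U V (fun k : ι => k.1.1 + s * k.2.1) (fun k => k.1.2 + s * k.2.2) c with hG
  have hdeg : p * (G j).natDegree ≤ s ^ 2 + (2 * d * p + 1) * s := by
    have : (G j).coeff (G j).natDegree ≠ 0 := by simpa using hne
    obtain ⟨⟨⟨a, b⟩, ⟨i, j'⟩⟩, -, hk⟩ := weight_sumCoord_le (by omega) hV hU hj this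
    have h1 := hl a b
    have h2 := hm i j'
    have h3 : s * (p * i + d * j') ≤ s * (s + 2 * d * p) := Nat.mul_le_mul_left _ (by omega)
    simp only at hk
    nlinarith
  refine le_trans (Nat.mul_le_mul_left p ?_) hdeg
  refine le_trans (Finset.card_le_card ?_) ((Multiset.toFinset_card_le _).trans (card_roots' (G j)))
  intro x hx
  rw [Multiset.mem_toFinset, mem_roots hne, IsRoot]
  obtain ⟨hxq, Z, hZc, hZ⟩ := hS x hx
  -- the remainder of degree `< p` vanishes at the `p` points of the fibre
  let H : F[X] := ∑ j ∈ Finset.range p, C ((G j).eval x) * X ^ j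
  have hH : H = 0 := by
    apply eq_zero_of_natDegree_lt_card_of_eval_eq_zero' H Z
    · intro z hz
      obtain ⟨hzq, hzp⟩ := hZ z hz
      have h1 := sum_eq_sum_sumCoord (ι := ι) (A := fun k => (k.1.1 : ℕ) + s * k.2.1)
        (B := fun k => k.1.2 + s * k.2.2) (c := c) (by omega) hzp
      simp only [H, eval_finsetSum, eval_mul, eval_C, eval_pow, eval_X]
      rw [← h1, ← pow_eq_zero_iff hs0.ne', hsp, sum_pow_char_pow, ← hsp]
      have h2 := sum_eq_sum_sumCoord (ι := ι) (A := fun k => s * k.1.1 + k.2.1)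
        (B := fun k => s * k.1.2 + k.2.2) (c := c') (by omega) hzp
      rw [Finset.sum_eq_zero (s := Finset.range p)] at h2
      · rw [← h2]
        refine Finset.sum_congr rfl fun k _ => ?_
        rw [mul_pow, hc, mul_pow]
        rw [hpow x hxq, hpow z hzq]
      · intro j hj
        rw [hc' j (Finset.mem_range.1 hj)]
        simp
    · rw [hZc, Nat.lt_iff_le_pred (by omega)]
      refine natDegree_sum_le_of_forall_le _ _ fun j hj => ?_
      refine (natDegree_C_mul_X_pow_le _ _).trans ?_
      rw [Finset.mem_range] at hj
      omega
  have := congrArg (fun P => P.coeff j) hH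
  simpa [H, finsetSum_coeff, coeff_X_pow, hj] using this

end Stepanov

section ArtinSchreier

variable {F : Type*} [Field F] {p : ℕ} [Fact p.Prime] [CharP F p]

theorem pow_eq_add_sum_pow_sub (y : F) (n : ℕ) :
    y ^ p ^ n = y + ∑ i ∈ Finset.range n, (y ^ p - y) ^ p ^ i := by
  have : ∀ i ∈ Finset.range n, (y ^ p - y) ^ p ^ i = y ^ p ^ (i + 1) - y ^ p ^ i := by
    intro i _
    rw [sub_pow_char_pow, ← pow_mul, pow_succ']
  rw [Finset.sum_congr rfl this, Finset.sum_range_sub (fun i => y ^ p ^ i)]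
  simp

theorem exists_pow_sub_self_eq [IsAlgClosed F] {N : ℕ} (hN : 2 ≤ N) (τ : F) :
    ∃ y : F, y ^ N - y = τ := by
  have hd : (X ^ N - X - C τ : F[X]).natDegree = N := by
    rw [natDegree_sub_C, natDegree_sub_eq_left_of_natDegree_lt] <;> simp
    omega
  obtain ⟨y, hy⟩ := IsAlgClosed.exists_root (X ^ N - X - C τ : F[X]) (by
    intro h
    have := natDegree_eq_zero_iff_degree_le_zero.2 h.le
    omega)
  refine ⟨y, ?_⟩
  simpa [IsRoot, sub_eq_zero] using hy

theorem eval_reflect_taylor (P : F[X]) {N : ℕ} (hN : P.natDegree ≤ N) {x α : F} (h : x ≠ α) :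
    (reflect N (taylor α P)).eval (x - α)⁻¹ = (x - α)⁻¹ ^ N * P.eval x := by
  have h0 : x - α ≠ 0 := sub_ne_zero.2 h
  let _ : Invertible (x - α) := invertibleOfNonzero h0
  have := eval₂_reflect_mul_pow (RingHom.id F) (x - α) N (taylor α P) (by rwa [natDegree_taylor])
  rw [← eval, ← eval, taylor_eval, sub_add_cancel, invOf_eq_inv] at this
  rw [← this, mul_left_comm, ← mul_pow, inv_mul_cancel₀ h0, one_pow, mul_one]

/-- An upper bound for the number of points with a prescribed absolute trace of a rational
function, over the field with `(p * p ^ ν) ^ 2` elements. -/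
theorem card_trace_eq_le [IsAlgClosed F] (hp : 3 ≤ p) {A Q : F[X]} {D d t ν : ℕ} {α : F}
    (hD : Q.natDegree = D) (hA : A.natDegree ≤ D + 1) (hQα : Q.eval α = 0)
    (hQα' : (derivative Q).eval α ≠ 0) (hAα : A.eval α ≠ 0) (hd : d = p * D + 1) (ht : t = p ^ ν)
    (htd : d * (d + 1) ≤ t) (hα : α ^ (p * t) ^ 2 = α) (S : Finset F) (τ : F)
    (hS : ∀ x ∈ S, x ^ (p * t) ^ 2 = x ∧ Q.eval x ≠ 0 ∧ Q.eval x ^ (p * t) ^ 2 = Q.eval x ∧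
      ∑ i ∈ Finset.range (2 * (ν + 1)), (A.eval x / Q.eval x) ^ p ^ i = τ) :
    p * S.card ≤ (p * t) ^ 2 + (2 * d * p + 1) * (p * t) := by
  classical
  have hq : (p * t) ^ 2 = p ^ (2 * (ν + 1)) := by rw [ht, ← pow_succ', ← pow_mul, mul_comm 2]
  have hp2 : 2 ≤ p := by omega
  obtain ⟨y₁, hy₁⟩ := exists_pow_sub_self_eq (F := F) (N := p ^ (2 * (ν + 1)))
    (hp2.trans (Nat.le_self_pow (by omega) p)) τ
  set e := y₁ ^ p - y₁ with he
  have htre : ∑ i ∈ Finset.range (2 * (ν + 1)), e ^ p ^ i = τ := by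
    rw [← hy₁, pow_eq_add_sum_pow_sub y₁]; ring
  have hQ0 : Q ≠ 0 := by rintro rfl; simp at hQα'
  have hD1 : 1 ≤ D := by
    rw [← hD, Nat.one_le_iff_ne_zero]
    intro h
    rw [eq_C_of_natDegree_eq_zero h] at hQα'
    simp at hQα'
  set b := reflect (D + 1) (taylor α Q) with hb
  set a := reflect (D + 1) (taylor α A) - C e * b with ha
  have hbtop : b.coeff (D + 1) = 0 := by
    rw [hb, coeff_reflect, revAt_le le_rfl, Nat.sub_self, taylor_coeff_zero, hQα]
  have hbD : b.coeff D ≠ 0 := by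
    rw [hb, coeff_reflect, revAt_le (by omega), Nat.add_sub_cancel_left, taylor_coeff_one]
    exact hQα'
  have hble : b.natDegree ≤ D + 1 := by
    refine natDegree_reflect_le.trans ?_
    rw [natDegree_taylor]; omega
  have hbdeg : b.natDegree = D := by
    refine le_antisymm ?_ (le_natDegree_of_ne_zero hbD)
    rw [natDegree_le_iff_coeff_eq_zero]
    intro N hN
    rcases (show D + 1 ≤ N from hN).eq_or_lt with rfl | h
    · exact hbtop
    · exact coeff_eq_zero_of_natDegree_lt (hble.trans_lt h)
  have hb0 : b ≠ 0 := by rintro h; rw [h] at hbD; simp at hbD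
  have hadeg : a.natDegree = D + 1 := by
    refine le_antisymm ?_ (le_natDegree_of_ne_zero ?_)
    · refine (natDegree_sub_le _ _).trans (max_le (natDegree_reflect_le.trans ?_)
        ((natDegree_C_mul_le _ _).trans hble))
      rw [natDegree_taylor]; omega
    · rw [ha, coeff_sub, coeff_C_mul, hbtop, coeff_reflect, revAt_le le_rfl, Nat.sub_self,
        taylor_coeff_zero]
      simpa using hAα
  have ha0 : a ≠ 0 := by rintro h; rw [h] at hadeg; simp at hadeg
  obtain ⟨P, hP⟩ : ∃ P, p = P + 1 := ⟨p - 1, by omega⟩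
  have hV : (b ^ (p - 1) * a).natDegree = d := by
    rw [natDegree_mul (pow_ne_zero _ hb0) ha0, natDegree_pow, hbdeg, hadeg, hd, hP]
    simp; ring
  have hU : p * (b ^ (p - 1)).natDegree < (p - 1) * d := by
    rw [natDegree_pow, hbdeg, hd]
    have : (p - 1) * (p * D + 1) = p * ((p - 1) * D) + (p - 1) := by ring
    omega
  have hpd : p.Coprime d := by
    rw [hd]
    simp
  have hinj : Set.InjOn (fun x => (x - α)⁻¹) (S : Set F) := by
    intro x _ y _ h
    simpa using h
  rw [← Finset.card_image_of_injOn hinj]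
  refine stepanov_card_le hp hpd (by omega) hV hU ht htd _ ?_
  intro u hu
  obtain ⟨x, hx, rfl⟩ := Finset.mem_image.1 hu
  obtain ⟨hxq, hQx, hQxq, htr⟩ := hS x hx
  have hxα : x ≠ α := by rintro rfl; exact hQx hQα
  have hu : ((x - α)⁻¹) ^ (p * t) ^ 2 = (x - α)⁻¹ := by
    rw [inv_pow, hq, sub_pow_char_pow, ← hq, hxq, hα]
  have hbu : b.eval (x - α)⁻¹ = (x - α)⁻¹ ^ (D + 1) * Q.eval x :=
    eval_reflect_taylor Q (by omega) hxα
  have hbu0 : b.eval (x - α)⁻¹ ≠ 0 := by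
    rw [hbu]
    exact mul_ne_zero (pow_ne_zero _ (inv_ne_zero (sub_ne_zero.2 hxα))) hQx
  have hau : a.eval (x - α)⁻¹ = b.eval (x - α)⁻¹ * (A.eval x / Q.eval x - e) := by
    rw [ha, eval_sub, eval_mul, eval_C, hbu, eval_reflect_taylor A hA hxα]
    field_simp
  obtain ⟨y₀, hy₀⟩ := exists_pow_sub_self_eq (F := F) hp2 (A.eval x / Q.eval x - e)
  have hy₀q : y₀ ^ (p * t) ^ 2 = y₀ := by
    rw [hq, pow_eq_add_sum_pow_sub y₀, hy₀]
    simp only [sub_pow_char_pow]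
    rw [Finset.sum_sub_distrib, htr, htre]
    simp
  let _ : Algebra (ZMod p) F := ZMod.algebra F p
  have hj : ∀ (j : ZMod p) (n : ℕ), (algebraMap (ZMod p) F j) ^ p ^ n = algebraMap (ZMod p) F j := by
    intro j n
    rw [← map_pow, ZMod.pow_card_pow]
  refine ⟨hu, Finset.univ.image fun j : ZMod p => b.eval (x - α)⁻¹ * (y₀ + algebraMap (ZMod p) F j),
    ?_, ?_⟩
  · rw [Finset.card_image_of_injective, Finset.card_univ, ZMod.card]
    intro j j' h
    have := mul_left_cancel₀ hbu0 h
    exact (algebraMap (ZMod p) F).injective (add_left_cancel this)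
  · intro z hz
    obtain ⟨j, -, rfl⟩ := Finset.mem_image.1 hz
    constructor
    · rw [mul_pow, hbu, mul_pow, hQxq, ← pow_mul, mul_comm (D + 1), pow_mul, hu]
      congr 1
      rw [hq, add_pow_char_pow, hj, ← hq, hy₀q]
    · rw [mul_pow, add_pow_char, show y₀ ^ p = y₀ + (A.eval x / Q.eval x - e) by rw [← hy₀]; ring]
      have := hj j 1
      rw [pow_one] at this
      rw [this, eval_mul, eval_pow, hau, ← pow_sub_one_mul (n := p) (by omega) (b.eval (x - α)⁻¹)]
      ring

end ArtinSchreier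

section TraceSum

variable {F : Type*} [Field F] {p : ℕ} [Fact p.Prime]

open scoped Classical in
/-- The elements of the subfield with `p ^ n` elements. -/
noncomputable def frobFixed (F : Type*) [Field F] (p n : ℕ) : Finset F :=
  (X ^ p ^ n - X : F[X]).roots.toFinset

theorem mem_frobFixed {n : ℕ} (hn : n ≠ 0) {x : F} : x ∈ frobFixed F p n ↔ x ^ p ^ n = x := by
  classical
  have h := FiniteField.X_pow_card_pow_sub_X_ne_zero F hn (Fact.out : p.Prime).one_lt
  simp [frobFixed, h, sub_eq_zero]

theorem card_frobFixed [IsAlgClosed F] [CharP F p] {n : ℕ} (hn : n ≠ 0) :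
    (frobFixed F p n).card = p ^ n := by
  classical
  have hsep := galois_poly_separable (K := F) p (p ^ n) (dvd_pow_self p hn)
  rw [frobFixed, Multiset.toFinset_card_of_nodup (nodup_roots hsep),
    ← (IsAlgClosed.splits _).natDegree_eq_card_roots,
    FiniteField.X_pow_card_pow_sub_X_natDegree_eq F hn (Fact.out : p.Prime).one_lt]

theorem aeval_pow_char_pow [Algebra (ZMod p) F] [CharP F p] (Q : (ZMod p)[X]) (x : F) (n : ℕ) :
    aeval x Q ^ p ^ n = aeval (x ^ p ^ n) Q := by
  have := hom_eval₂ Q (algebraMap (ZMod p) F) (iterateFrobenius F p n) x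
  rw [Subsingleton.elim ((iterateFrobenius F p n).comp (algebraMap (ZMod p) F))
    (algebraMap (ZMod p) F)] at this
  simpa [iterateFrobenius_def, aeval_def] using this

/-- The sum of the first `n` conjugates of `y` under the Frobenius map. -/
def frobTrace (p n : ℕ) (y : F) : F := ∑ i ∈ Finset.range n, y ^ p ^ i

theorem mem_range_algebraMap_of_pow_eq [Algebra (ZMod p) F] [CharP F p] {t : F} (ht : t ^ p = t) :
    ∃ j : ZMod p, algebraMap (ZMod p) F j = t := by
  have := (Subfield.mem_bot_iff_pow_eq_self F p).2 ht
  obtain ⟨j, hj⟩ := (mem_bot_iff_intCast p F).1 this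
  exact ⟨j, by rw [map_intCast, hj]⟩

theorem frobTrace_pow [CharP F p] {n : ℕ} {y : F} (hy : y ^ p ^ n = y) :
    frobTrace p n y ^ p = frobTrace p n y := by
  have := sum_pow_char p (Finset.range n) fun i => y ^ p ^ i
  rw [frobTrace, this]
  have h : ∀ i ∈ Finset.range n, (y ^ p ^ i) ^ p = y ^ p ^ (i + 1) := by
    intro i _; rw [← pow_mul, pow_succ]
  rw [Finset.sum_congr rfl h, ← sub_eq_zero, ← Finset.sum_sub_distrib,
    Finset.sum_range_sub (fun i => y ^ p ^ i)]
  simp [hy]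

theorem exists_pow_char_pow_eq_self [Algebra (ZMod p) F] [Algebra.IsAlgebraic (ZMod p) F] (α : F) :
    ∃ n ≠ 0, ∀ j, α ^ p ^ (n * j) = α := by
  have hα : IsIntegral (ZMod p) α := Algebra.IsIntegral.isIntegral α
  have := IntermediateField.adjoin.finiteDimensional hα
  let E := IntermediateField.adjoin (ZMod p) {α}
  have : Finite E := Module.finite_of_finite (ZMod p)
  let _ : Fintype E := Fintype.ofFinite E
  refine ⟨Module.finrank (ZMod p) E, Module.finrank_pos.ne', fun j => ?_⟩
  have h := FiniteField.pow_card_pow j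
    (⟨α, IntermediateField.mem_adjoin_simple_self (ZMod p) α⟩ : E)
  rw [Module.card_eq_pow_finrank (K := ZMod p), ZMod.card, ← pow_mul] at h
  exact congrArg Subtype.val h

open scoped Classical in
/-- The exponential sum of `A / Q` over the field with `p ^ n` elements. -/
noncomputable def expSum [Algebra (ZMod p) F] (Ψ : AddChar F ℂ) (A Q : (ZMod p)[X]) (n : ℕ) : ℂ :=
  ∑ x ∈ frobFixed F p n with aeval x Q ≠ 0, Ψ (frobTrace p n (aeval x A / aeval x Q))

theorem norm_expSum_le [IsAlgClosed F] [Algebra (ZMod p) F] [CharP F p]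
    [Algebra.IsAlgebraic (ZMod p) F]
    (hp : 3 ≤ p) (Ψ : AddChar F ℂ)
    (hΨ : ∀ j : ZMod p, Ψ (algebraMap (ZMod p) F j) = ZMod.stdAddChar j) {A Q : (ZMod p)[X]}
    (hQ : Squarefree Q) (hQ1 : 1 ≤ Q.natDegree) (hAQ : IsCoprime A Q)
    (hA : A.natDegree ≤ Q.natDegree + 1) :
    ∃ C : ℝ, ∃ N ≠ 0, ∀ j ≠ 0, ‖expSum Ψ A Q (2 * (N * j))‖ ≤ C * (p : ℝ) ^ (N * j) := by
  classical
  set D := Q.natDegree with hD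
  obtain ⟨α, hα⟩ := IsAlgClosed.exists_aeval_eq_zero F Q (by
    intro h
    have := natDegree_eq_zero_iff_degree_le_zero.2 h.le
    omega)
  have hsep : Q.Separable := PerfectField.separable_iff_squarefree.2 hQ
  have hα' : aeval α (derivative Q) ≠ 0 := hsep.aeval_derivative_ne_zero hα
  have hAα : aeval α A ≠ 0 := by
    intro h
    obtain ⟨u, v, huv⟩ := hAQ
    have := congrArg (aeval α) huv
    simp [h, hα] at this
  obtain ⟨n₀, hn₀, hαn⟩ := exists_pow_char_pow_eq_self (p := p) α
  set d := p * D + 1 with hd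
  refine ⟨2 * d * p + 1 + D, n₀ * (d * (d + 1) + 1), by positivity, fun j hj => ?_⟩
  obtain ⟨ν, hν⟩ : ∃ ν, n₀ * (d * (d + 1) + 1) * j = ν + 1 :=
    Nat.exists_eq_succ_of_ne_zero (by positivity)
  have hν' : d * (d + 1) ≤ ν := by
    have : 1 * (d * (d + 1) + 1) * 1 ≤ n₀ * (d * (d + 1) + 1) * j := by
      gcongr <;> omega
    omega
  rw [hν]
  set n := 2 * (ν + 1) with hn
  have hn0 : n ≠ 0 := by omega
  set t := p ^ ν with ht
  have hq : (p * t) ^ 2 = p ^ n := by rw [ht, ← pow_succ', ← pow_mul, mul_comm, hn]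
  set T := (frobFixed F p n).filter (fun x => aeval x Q ≠ 0) with hT
  have hTcard : p ^ n ≤ T.card + D := by
    rw [← card_frobFixed (F := F) (p := p) hn0,
      ← Finset.card_filter_add_card_filter_not (s := frobFixed F p n) (fun x => aeval x Q ≠ 0)]
    gcongr
    rw [hD, ← natDegree_map (algebraMap (ZMod p) F)]
    refine le_trans (Finset.card_le_card ?_) ((Q.map _).roots.toFinset_card_le.trans
      (card_roots' _))
    intro x hx
    have hQ0 : Q ≠ 0 := hQ.ne_zero
    rw [Multiset.mem_toFinset, mem_roots (map_ne_zero hQ0), IsRoot, eval_map_algebraMap]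
    exact not_not.1 (Finset.mem_filter.1 hx).2
  let tr : F → F := fun x => frobTrace p n (aeval x A / aeval x Q)
  have hfib : ∀ j : ZMod p,
      p * (T.filter fun x => tr x = algebraMap (ZMod p) F j).card ≤
        (p * t) ^ 2 + (2 * d * p + 1) * (p * t) := by
    intro j
    refine card_trace_eq_le (A := A.map (algebraMap (ZMod p) F))
      (Q := Q.map (algebraMap (ZMod p) F)) (α := α) (τ := algebraMap (ZMod p) F j) hp
      (natDegree_map _) (by rwa [natDegree_map]) ?_ ?_ ?_ hd ht ?_ ?_ _ ?_
    · rwa [eval_map_algebraMap]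
    · rwa [derivative_map, eval_map_algebraMap]
    · rwa [eval_map_algebraMap]
    · exact hν'.trans (Nat.lt_pow_self (by omega)).le
    · rw [hq, hn, mul_comm, ← hν, mul_assoc, mul_assoc]
      exact hαn _
    · intro x hx
      simp only [hT, Finset.mem_filter, mem_frobFixed hn0] at hx
      simp only [eval_map_algebraMap, hq]
      refine ⟨hx.1.1, hx.1.2, ?_, hx.2⟩
      rw [aeval_pow_char_pow, hx.1.1]
  have htr : ∀ x ∈ T, ∃ j : ZMod p, algebraMap (ZMod p) F j = tr x := by
    intro x hx
    simp only [hT, Finset.mem_filter, mem_frobFixed hn0] at hx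
    refine mem_range_algebraMap_of_pow_eq (frobTrace_pow ?_)
    rw [div_pow, aeval_pow_char_pow, aeval_pow_char_pow, hx.1]
  choose! τ hτ using htr
  have hfil : ∀ j : ZMod p, (T.filter fun x => tr x = algebraMap (ZMod p) F j) =
      T.filter fun x => τ x = j := by
    intro j
    refine Finset.filter_congr fun x hx => ?_
    rw [← hτ x hx, (algebraMap (ZMod p) F).injective.eq_iff]
  simp only [hfil] at hfib
  have hsum : expSum Ψ A Q n = ∑ j : ZMod p, ((T.filter fun x => τ x = j).card : ℂ) *
      ZMod.stdAddChar j := by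
    have : expSum Ψ A Q n = ∑ x ∈ T, ZMod.stdAddChar (τ x) := by
      refine Finset.sum_congr rfl fun x hx => ?_
      rw [← hΨ, hτ x hx]
    rw [this, ← Finset.sum_fiberwise T τ]
    refine Finset.sum_congr rfl fun j _ => ?_
    rw [← nsmul_eq_mul, ← Finset.sum_const]
    exact Finset.sum_congr rfl fun x hx => by rw [(Finset.mem_filter.1 hx).2]
  have hstd : ∑ j : ZMod p, ZMod.stdAddChar (N := p) j = (0 : ℂ) := by
    refine AddChar.sum_eq_zero_of_ne_one ?_
    intro h
    have := ZMod.isPrimitive_stdAddChar p (a := 1) one_ne_zero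
    simp [h] at this
  set B : ℝ := ((p * t) ^ 2 + (2 * d * p + 1) * (p * t)) / p with hB
  have hp0 : (0 : ℝ) < p := by exact_mod_cast (show 0 < p by omega)
  have hfibR : ∀ j : ZMod p, ((T.filter fun x => τ x = j).card : ℝ) ≤ B := by
    intro j
    rw [hB, le_div_iff₀ hp0, mul_comm]
    exact_mod_cast hfib j
  have hsum' : expSum Ψ A Q n = ∑ j : ZMod p, (((T.filter fun x => τ x = j).card - B : ℝ) : ℂ) *
      ZMod.stdAddChar j := by
    simp only [Complex.ofReal_sub, sub_mul, Finset.sum_sub_distrib, ← Finset.mul_sum, hstd]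
    rw [hsum]; simp
  have hcardT : ∑ j : ZMod p, ((T.filter fun x => τ x = j).card : ℝ) = T.card := by
    exact_mod_cast (Finset.card_eq_sum_card_fiberwise (f := τ) (t := Finset.univ)
      (fun x _ => by simp)).symm
  calc ‖expSum Ψ A Q n‖ ≤ ∑ j : ZMod p, (B - (T.filter fun x => τ x = j).card) := by
        rw [hsum']
        refine (norm_sum_le _ _).trans (Finset.sum_le_sum fun j _ => ?_)
        rw [norm_mul, AddChar.norm_apply, mul_one, Complex.norm_real, Real.norm_eq_abs, abs_sub_comm,
          abs_of_nonneg (sub_nonneg.2 (hfibR j))]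
    _ = p * B - T.card := by
        rw [Finset.sum_sub_distrib, hcardT]
        simp
    _ = (p * t) ^ 2 + (2 * d * p + 1) * (p * t) - T.card := by
        rw [hB]; field_simp
    _ ≤ (2 * d * p + 1) * (p * t) + D := by
        have : ((p * t : ℝ)) ^ 2 ≤ T.card + D := by exact_mod_cast hq ▸ hTcard
        linarith
    _ ≤ (2 * d * p + 1 + D) * (p : ℝ) ^ (ν + 1) := by
        have h1 : ((p * t : ℕ) : ℝ) = (p : ℝ) ^ (ν + 1) := by rw [ht, ← pow_succ']; push_cast; rfl
        push_cast at h1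
        have h2 : (1 : ℝ) ≤ (p : ℝ) ^ (ν + 1) := one_le_pow₀ (by exact_mod_cast (by omega : 1 ≤ p))
        have h3 : (0 : ℝ) ≤ D := by positivity
        rw [h1]
        nlinarith
    _ = _ := by rw [hd]

end TraceSum

section PowerSums

theorem exists_sum_pow_eq_of_newton {N : ℕ} {a S : ℕ → ℂ} (ha0 : a 0 = 1)
    (ha : ∀ n, N < n → a n = 0)
    (h : ∀ n : ℕ, (n : ℂ) * a n =
      ∑ x ∈ Finset.HasAntidiagonal.antidiagonal n with x.1 < n, a x.1 * S x.2) :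
    ∃ (ι : Type) (_ : Fintype ι) (ω : ι → ℂ), Fintype.card ι = N ∧
      ∀ n ≠ 0, S n = -∑ i, ω i ^ n := by
  classical
  let P : ℂ[X] := ∑ n ∈ Finset.range (N + 1), C (a (N - n)) * X ^ n
  have hcoeff : ∀ k ≤ N, P.coeff k = a (N - k) := by
    intro k hk
    simp [P, finsetSum_coeff, coeff_C_mul, coeff_X_pow, Nat.lt_succ_of_le hk]
  have hle : P.natDegree ≤ N :=
    natDegree_sum_le_of_forall_le _ _ fun n hn =>
      (natDegree_C_mul_X_pow_le _ _).trans (by simpa [Nat.lt_succ_iff] using hn)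
  have hdeg : P.natDegree = N := by
    refine le_antisymm hle (le_natDegree_of_ne_zero ?_)
    rw [hcoeff N le_rfl, Nat.sub_self, ha0]; exact one_ne_zero
  have hlead : P.leadingCoeff = 1 := by
    rw [leadingCoeff, hdeg, hcoeff N le_rfl, Nat.sub_self, ha0]
  have hroots : Multiset.card P.roots = P.natDegree :=
    (IsAlgClosed.splits P).natDegree_eq_card_roots.symm
  let ω : P.roots.ToType → ℂ := fun x => x.1
  have hω : (Finset.univ : Finset P.roots.ToType).val.map ω = P.roots := Multiset.map_univ_coe _
  have hcard : Fintype.card P.roots.ToType = N := by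
    rw [Multiset.card_coe, hroots, hdeg]
  have hesymm : ∀ n, a n = (-1) ^ n * MvPolynomial.aeval ω (MvPolynomial.esymm _ ℂ n) := by
    intro n
    rw [MvPolynomial.aeval_esymm_eq_multiset_esymm, hω]
    rcases le_or_gt n N with hn | hn
    · have := coeff_eq_esymm_roots_of_card hroots (k := N - n) (by omega)
      rw [hcoeff _ (by omega), hlead, one_mul, hdeg, Nat.sub_sub_self hn] at this
      exact this
    · rw [ha n hn, Multiset.esymm, Multiset.powersetCard_eq_empty _ (by omega)]
      simp
  refine ⟨P.roots.ToType, inferInstance, ω, hcard, fun n => ?_⟩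
  induction n using Nat.strong_induction_on with
  | _ n ih =>
  intro hn
  have newton := congrArg (MvPolynomial.aeval ω) (MvPolynomial.mul_esymm_eq_sum P.roots.ToType ℂ n)
  simp only [map_mul, map_natCast, map_pow, map_neg, map_one, map_sum, MvPolynomial.psum,
    MvPolynomial.aeval_X] at newton
  have h1 : (n : ℂ) * a n = -∑ x ∈ Finset.HasAntidiagonal.antidiagonal n with x.1 < n,
      a x.1 * ∑ i, ω i ^ x.2 := by
    rw [hesymm n, mul_left_comm, newton, ← mul_assoc, ← pow_add,
      Odd.neg_one_pow ⟨n, by ring⟩, neg_one_mul]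
    congr 1
    exact Finset.sum_congr rfl fun x _ => by rw [hesymm x.1]
  have h2 : ∑ x ∈ Finset.HasAntidiagonal.antidiagonal n with x.1 < n, a x.1 * (S x.2 + ∑ i, ω i ^ x.2) = 0 := by
    simp only [mul_add, Finset.sum_add_distrib]
    rw [← h n, h1]; ring
  rw [Finset.sum_eq_single_of_mem (0, n)] at h2
  · rw [ha0, one_mul] at h2
    exact eq_neg_of_add_eq_zero_left h2
  · simp [Nat.pos_of_ne_zero hn]
  · rintro ⟨x, y⟩ hx hne
    simp only [Finset.mem_filter, Finset.HasAntidiagonal.mem_antidiagonal] at hx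
    have hx0 : x ≠ 0 := by
      rintro rfl
      apply hne
      simp only [zero_add] at hx
      rw [hx.1]
    dsimp only
    rw [ih y (by omega) (by omega), neg_add_cancel, mul_zero]

theorem exists_pow_near_one {ι : Type*} [Fintype ι] {u : ι → ℂ} (hu : ∀ i, ‖u i‖ = 1) (M : ℕ) :
    ∃ j ≥ M, ∀ i, ‖u i ^ j - 1‖ ≤ 1 / 2 := by
  have hmem : ∀ j : ℕ, (fun i => u i ^ j) ∈ Metric.closedBall (0 : ι → ℂ) 1 := by
    intro j
    rw [mem_closedBall_zero_iff, pi_norm_le_iff_of_nonneg zero_le_one]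
    intro i; simp [hu]
  obtain ⟨l, -, φ, hφ, hl⟩ := tendsto_subseq_of_bounded Metric.isBounded_closedBall hmem
  obtain ⟨N₀, hN₀⟩ := Metric.cauchySeq_iff'.1 hl.cauchySeq (1 / 2) (by norm_num)
  refine ⟨φ (M + N₀) - φ N₀, ?_, fun i => ?_⟩
  · have := hφ.add_le_nat M N₀
    omega
  · have h1 := hN₀ (M + N₀) (by omega)
    rw [dist_eq_norm] at h1
    have h2 := (norm_le_pi_norm _ i).trans h1.le
    have h3 : φ (M + N₀) = φ N₀ + (φ (M + N₀) - φ N₀) := by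
      have := hφ.monotone (show N₀ ≤ M + N₀ by omega)
      omega
    have h4 : u i ^ φ (M + N₀) - u i ^ φ N₀ = u i ^ φ N₀ * (u i ^ (φ (M + N₀) - φ N₀) - 1) := by
      rw [mul_sub, ← pow_add, ← h3, mul_one]
    simp only [Function.comp, Pi.sub_apply] at h2
    rwa [h4, norm_mul, norm_pow, hu, one_pow, one_mul] at h2

theorem norm_le_of_norm_sum_pow_le {ι : Type*} [Fintype ι] {z : ι → ℂ} {C B : ℝ} (hB : 0 < B)
    (h : ∀ j ≠ 0, ‖∑ i, z i ^ j‖ ≤ C * B ^ j) (i : ι) : ‖z i‖ ≤ B := by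
  by_contra! hlt
  have htend := tendsto_pow_atTop_atTop_of_one_lt ((one_lt_div hB).2 hlt)
  obtain ⟨M, hM⟩ := Filter.eventually_atTop.1 (htend.eventually_gt_atTop (2 * C))
  let u : ι → ℂ := fun i => Complex.exp (Complex.arg (z i) * Complex.I)
  have hu : ∀ i, ‖u i‖ = 1 := fun i => Complex.norm_exp_ofReal_mul_I _
  obtain ⟨j, hj, hju⟩ := exists_pow_near_one hu (M + 1)
  have hz : ∀ i, z i ^ j = ((‖z i‖ ^ j : ℝ) : ℂ) * u i ^ j := by
    intro i
    rw [Complex.ofReal_pow, ← mul_pow, Complex.norm_mul_exp_arg_mul_I]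
  have hre : ∀ i, ‖z i‖ ^ j / 2 ≤ (z i ^ j).re := by
    intro i
    rw [hz, Complex.re_ofReal_mul, div_eq_mul_inv]
    gcongr
    have := (Complex.abs_re_le_norm _).trans (hju i)
    rw [Complex.sub_re, Complex.one_re] at this
    have := (abs_le.1 this).1
    linarith
  have h1 : ‖z i‖ ^ j / 2 ≤ C * B ^ j := by
    calc ‖z i‖ ^ j / 2 ≤ ∑ i, ‖z i‖ ^ j / 2 :=
          Finset.single_le_sum (f := fun i => ‖z i‖ ^ j / 2) (fun i _ => by positivity)
            (Finset.mem_univ i)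
      _ ≤ ∑ i, (z i ^ j).re := Finset.sum_le_sum fun i _ => hre i
      _ = (∑ i, z i ^ j).re := by rw [Complex.re_sum]
      _ ≤ _ := (Complex.re_le_norm _).trans (h j (by omega))
  have h2 := hM j (by omega)
  rw [div_pow, lt_div_iff₀ (by positivity)] at h2
  linarith

/-- If the power sums coming from a polynomial `L`-function are small along a progression,
then all of them satisfy the Riemann hypothesis bound. -/
theorem norm_le_of_newton {D : ℕ} {a S : ℕ → ℂ} (ha0 : a 0 = 1)
    (ha : ∀ n, D < n → a n = 0)
    (h : ∀ n : ℕ, (n : ℂ) * a n =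
      ∑ x ∈ Finset.HasAntidiagonal.antidiagonal n with x.1 < n, a x.1 * S x.2)
    {q : ℝ} (hq : 0 < q) {C : ℝ} {N : ℕ} (hN : N ≠ 0)
    (hS : ∀ j ≠ 0, ‖S (2 * (N * j))‖ ≤ C * q ^ (N * j)) : ‖S 1‖ ≤ D * √q := by
  obtain ⟨ι, _, ω, hcard, hω⟩ := exists_sum_pow_eq_of_newton ha0 ha h
  have hbd : ∀ i, ‖ω i‖ ≤ √q := by
    intro i
    have := norm_le_of_norm_sum_pow_le (z := fun i => ω i ^ (2 * N)) (C := C) (B := q ^ N)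
      (by positivity) (fun j hj => by
        have h1 := hS j hj
        rw [hω _ (by positivity), norm_neg, ← mul_assoc] at h1
        simpa only [← pow_mul] using h1) i
    rw [norm_pow, pow_mul] at this
    have h2 := le_of_pow_le_pow_left₀ hN hq.le this
    exact Real.le_sqrt_of_sq_le h2
  rw [hω 1 one_ne_zero, norm_neg]
  refine (norm_sum_le _ _).trans ?_
  simp only [pow_one]
  refine (Finset.sum_le_sum fun i _ => hbd i).trans ?_
  simp [hcard]

end PowerSums

section RootSum

variable {F : Type*} [Field F] {p : ℕ} [Fact p.Prime] [Algebra (ZMod p) F]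

/-- The sum of `A / Q` over the roots of `h`, with multiplicity. -/
noncomputable def rootSum (F : Type*) [Field F] [Algebra (ZMod p) F] (A Q h : (ZMod p)[X]) : F :=
  ((h.aroots F).map fun x => aeval x A / aeval x Q).sum

theorem rootSum_mul (A Q : (ZMod p)[X]) {h k : (ZMod p)[X]} (hk : h * k ≠ 0) :
    rootSum F A Q (h * k) = rootSum F A Q h + rootSum F A Q k := by
  rw [rootSum, aroots_mul hk, Multiset.map_add, Multiset.sum_add]
  rfl

theorem rootSum_pow (A Q h : (ZMod p)[X]) (k : ℕ) :
    rootSum F A Q (h ^ k) = k * rootSum F A Q h := by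
  rw [rootSum, aroots_pow, Multiset.map_nsmul, Multiset.sum_nsmul, nsmul_eq_mul]
  rfl

variable [Algebra.IsAlgebraic (ZMod p) F]

theorem pow_char_pow_eq_self_iff {x : F} {m : ℕ} :
    x ^ p ^ m = x ↔ (minpoly (ZMod p) x).natDegree ∣ m := by
  have hx : IsIntegral (ZMod p) x := Algebra.IsIntegral.isIntegral x
  rw [(minpoly.irreducible hx).natDegree_dvd_iff_dvd_X_pow_card_pow_sub_X, minpoly.dvd_iff]
  simp [sub_eq_zero]

theorem frobTrace_mul {d k : ℕ} {y : F} (hy : y ^ p ^ d = y) :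
    frobTrace p (d * k) y = k * frobTrace p d y := by
  induction k with
  | zero => simp [frobTrace]
  | succ k ih =>
    have hk : y ^ p ^ (d * k) = y := by
      rw [pow_char_pow_eq_self_iff] at hy ⊢
      exact hy.mul_right k
    rw [Nat.mul_succ, frobTrace, Finset.sum_range_add, ← frobTrace, ih]
    simp only [pow_add, frobTrace]
    push_cast
    rw [add_mul, one_mul]
    congr 1
    refine Finset.sum_congr rfl fun i _ => ?_
    rw [pow_mul, hk]

theorem rootSum_minpoly [IsAlgClosed F] (A Q : (ZMod p)[X]) (x : F) :
    rootSum F A Q (minpoly (ZMod p) x) =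
      frobTrace p (minpoly (ZMod p) x).natDegree (aeval x A / aeval x Q) := by
  classical
  have hx : IsIntegral (ZMod p) x := Algebra.IsIntegral.isIntegral x
  have := IntermediateField.adjoin.finiteDimensional hx
  let E := IntermediateField.adjoin (ZMod p) {x}
  have : Finite E := Module.finite_of_finite (ZMod p)
  let g : E := IntermediateField.AdjoinSimple.gen (ZMod p) x
  let y : E := aeval g A / aeval g Q
  have hσ : ∀ σ : E →ₐ[ZMod p] F, σ y = aeval (σ g) A / aeval (σ g) Q := by
    intro σ
    simp only [y, map_div₀, aeval_algHom_apply]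
  have hy : algebraMap E F y = aeval x A / aeval x Q := by
    exact hσ E.val
  have h1 := trace_eq_sum_embeddings (K := ZMod p) (x := y) F
  have h2 := congrArg (algebraMap E F) (FiniteField.algebraMap_trace_eq_sum_pow (ZMod p) E y)
  rw [← IsScalarTower.algebraMap_apply, h1, IntermediateField.adjoin.finrank hx] at h2
  simp only [Nat.card_zmod, map_sum, map_pow, hy] at h2
  rw [frobTrace, ← h2, rootSum]
  have hsep : (minpoly (ZMod p) x).Separable := PerfectField.separable_of_irreducible (minpoly.irreducible hx)
  have hnd : ((minpoly (ZMod p) x).aroots F).Nodup := nodup_roots hsep.map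
  let e := IntermediateField.algHomAdjoinIntegralEquiv (ZMod p) hx (K := F)
  have he : ∀ z, e.symm z g = z.1 := fun z =>
    IntermediateField.algHomAdjoinIntegralEquiv_symm_apply_gen (ZMod p) hx z
  refine (Finset.sum_subtype ⟨_, hnd⟩ (fun _ => Iff.rfl) fun z => aeval z A / aeval z Q).trans
    (Fintype.sum_equiv e.symm _ _ fun z => ?_)
  rw [hσ, he]

theorem minpoly_pow_dvd_iff {x : F} {h : (ZMod p)[X]} (hh : h ≠ 0) {k : ℕ} :
    minpoly (ZMod p) x ^ k ∣ h ↔ k ≤ (h.map (algebraMap (ZMod p) F)).rootMultiplicity x := by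
  have hx : IsIntegral (ZMod p) x := Algebra.IsIntegral.isIntegral x
  set π := minpoly (ZMod p) x with hπ
  have hπ0 : π ≠ 0 := minpoly.ne_zero hx
  have hπx : X - C x ∣ π.map (algebraMap (ZMod p) F) := by
    rw [dvd_iff_isRoot, IsRoot, eval_map_algebraMap, minpoly.aeval]
  constructor
  · intro hd
    rw [le_rootMultiplicity_iff (map_ne_zero hh)]
    have := Polynomial.map_dvd (algebraMap (ZMod p) F) hd
    rw [Polynomial.map_pow] at this
    exact (pow_dvd_pow_of_dvd hπx k).trans this
  · induction k generalizing h with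
    | zero => simp
    | succ k ih =>
      intro hk
      have hroot : aeval x h = 0 := by
        have := (rootMultiplicity_pos (map_ne_zero hh)).1 (lt_of_lt_of_le k.succ_pos hk)
        rwa [IsRoot, eval_map_algebraMap] at this
      obtain ⟨h', rfl⟩ := minpoly.dvd_iff.2 hroot
      rw [pow_succ']
      refine mul_dvd_mul_left _ (ih (right_ne_zero_of_mul hh) ?_)
      have hsep : (π.map (algebraMap (ZMod p) F)).Separable :=
        (PerfectField.separable_of_irreducible (minpoly.irreducible hx)).map
      have h1 := rootMultiplicity_le_one_of_separable hsep x
      rw [Polynomial.map_mul, rootMultiplicity_mul (by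
        rw [← Polynomial.map_mul]; exact map_ne_zero hh), ← hπ] at hk
      omega

end RootSum

section Recurrence

theorem finite_monic_natDegree_eq (R : Type*) [Semiring R] [Finite R] (n : ℕ) :
    {h : R[X] | h.Monic ∧ h.natDegree = n}.Finite := by
  refine Set.Finite.of_injOn (f := fun h (i : Fin (n + 1)) => h.coeff i)
    (t := Set.univ) (fun _ _ => Set.mem_univ _) ?_ Set.finite_univ
  rintro h ⟨-, hh⟩ k ⟨-, hk⟩ heq
  ext i
  rcases lt_or_ge i (n + 1) with hi | hi
  · exact congrFun heq ⟨i, hi⟩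
  · rw [coeff_eq_zero_of_natDegree_lt (by omega), coeff_eq_zero_of_natDegree_lt (by omega)]

/-- The monic polynomials of degree `n`. -/
noncomputable def monicsOfDegree (R : Type*) [Semiring R] [Finite R] (n : ℕ) : Finset R[X] :=
  (finite_monic_natDegree_eq R n).toFinset

theorem mem_monicsOfDegree {R : Type*} [Semiring R] [Finite R] {n : ℕ} {h : R[X]} :
    h ∈ monicsOfDegree R n ↔ h.Monic ∧ h.natDegree = n := by
  simp [monicsOfDegree]

variable {F : Type*} [Field F] {p : ℕ} [Fact p.Prime] [Algebra (ZMod p) F]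

open scoped Classical in
/-- The multiplicative character attached to the additive character `Ψ` and `A / Q`. -/
noncomputable def rootChar (Ψ : AddChar F ℂ) (A Q h : (ZMod p)[X]) : ℂ :=
  if IsCoprime h Q then Ψ (rootSum F A Q h) else 0

/-- The coefficients of the `L`-function attached to `rootChar`. -/
noncomputable def rootCharSum (Ψ : AddChar F ℂ) (A Q : (ZMod p)[X]) (n : ℕ) : ℂ :=
  ∑ h ∈ monicsOfDegree (ZMod p) n, rootChar Ψ A Q h

variable {Ψ : AddChar F ℂ} {A Q : (ZMod p)[X]}

theorem rootChar_mul {h k : (ZMod p)[X]} (hk : h * k ≠ 0) :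
    rootChar Ψ A Q (h * k) = rootChar Ψ A Q h * rootChar Ψ A Q k := by
  classical
  simp only [rootChar, IsCoprime.mul_left_iff, rootSum_mul A Q hk, AddChar.map_add_eq_mul]
  split_ifs <;> simp_all

theorem rootCharSum_zero : rootCharSum Ψ A Q 0 = 1 := by
  have : monicsOfDegree (ZMod p) 0 = {1} := by
    ext h
    rw [mem_monicsOfDegree, Finset.mem_singleton]
    constructor
    · rintro ⟨h1, h2⟩
      exact h1.natDegree_eq_zero.1 h2
    · rintro rfl
      simp
  rw [rootCharSum, this, Finset.sum_singleton, rootChar, if_pos isCoprime_one_left]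
  simp [rootSum]

variable [Algebra.IsAlgebraic (ZMod p) F] [IsAlgClosed F]

open scoped Classical in
theorem rootChar_minpoly_pow {x : F} {m : ℕ} (hm : m ≠ 0) (hx : x ^ p ^ m = x) :
    rootChar Ψ A Q (minpoly (ZMod p) x ^ (m / (minpoly (ZMod p) x).natDegree)) =
      if aeval x Q ≠ 0 then Ψ (frobTrace p m (aeval x A / aeval x Q)) else 0 := by
  have hxi : IsIntegral (ZMod p) x := Algebra.IsIntegral.isIntegral x
  obtain ⟨k, hk⟩ := pow_char_pow_eq_self_iff.1 hx
  set d := (minpoly (ZMod p) x).natDegree with hd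
  have hd0 : 0 < d := minpoly.natDegree_pos hxi
  have hk0 : 0 < k := Nat.pos_of_ne_zero (by rintro rfl; simp at hk; exact hm hk)
  have hxd : x ^ p ^ d = x := pow_char_pow_eq_self_iff.2 dvd_rfl
  have : CharP F p := charP_of_injective_algebraMap (algebraMap (ZMod p) F).injective p
  rw [hk, Nat.mul_div_cancel_left _ hd0, rootChar, rootSum_pow, rootSum_minpoly, ← hd,
    ← frobTrace_mul (by rw [div_pow, aeval_pow_char_pow, aeval_pow_char_pow, hxd]),
    IsCoprime.pow_left_iff hk0, (minpoly.irreducible hxi).coprime_iff_not_dvd, minpoly.dvd_iff]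
  congr

open scoped Classical in
theorem sum_card_minpoly_pow_dvd {h : (ZMod p)[X]} (hh : h ≠ 0) {n : ℕ} (hn : h.natDegree = n) :
    ∑ z ∈ Finset.HasAntidiagonal.antidiagonal n with z.1 < n,
      ((frobFixed F p z.2).filter fun x =>
        minpoly (ZMod p) x ^ (z.2 / (minpoly (ZMod p) x).natDegree) ∣ h).card = n := by
  set H := h.map (algebraMap (ZMod p) F) with hH
  have hH0 : H ≠ 0 := map_ne_zero hh
  have hdeg : ∀ x : F, 0 < (minpoly (ZMod p) x).natDegree := fun x =>
    minpoly.natDegree_pos (Algebra.IsIntegral.isIntegral x)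
  have hcount : ∀ x : F, ((Finset.HasAntidiagonal.antidiagonal n).filter fun z : ℕ × ℕ => z.1 < n ∧
      (minpoly (ZMod p) x).natDegree ∣ z.2 ∧
        minpoly (ZMod p) x ^ (z.2 / (minpoly (ZMod p) x).natDegree) ∣ h).card =
      H.rootMultiplicity x := by
    intro x
    set d := (minpoly (ZMod p) x).natDegree with hd
    have hd0 := hdeg x
    have hle : ∀ k ≤ H.rootMultiplicity x, d * k ≤ n := by
      intro k hk
      have := natDegree_le_of_dvd ((minpoly_pow_dvd_iff hh).2 hk) hh
      rwa [natDegree_pow, hn, mul_comm] at this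
    rw [← Nat.add_sub_cancel (H.rootMultiplicity x) 1, ← Nat.card_Icc]
    symm
    refine Finset.card_nbij' (fun k => (n - d * k, d * k)) (fun z => z.2 / d) ?_ ?_ ?_ ?_
    · intro k hk
      simp only [Finset.coe_Icc, Set.mem_Icc] at hk
      have := hle k hk.2
      have h1 : 0 < d * k := Nat.mul_pos hd0 (by omega)
      simp only [Finset.coe_filter, Finset.HasAntidiagonal.mem_antidiagonal, Set.mem_ofPred_eq]
      refine ⟨by omega, by omega, Dvd.intro _ rfl, ?_⟩
      rw [Nat.mul_div_cancel_left _ hd0]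
      exact (minpoly_pow_dvd_iff hh).2 hk.2
    · rintro ⟨a, b⟩ hz
      simp only [Finset.coe_filter, Finset.HasAntidiagonal.mem_antidiagonal, Set.mem_ofPred_eq] at hz
      simp only [Finset.coe_Icc, Set.mem_Icc]
      refine ⟨Nat.div_pos (Nat.le_of_dvd (by omega) hz.2.2.1) hd0,
        (minpoly_pow_dvd_iff hh).1 hz.2.2.2⟩
    · intro k _
      exact Nat.mul_div_cancel_left _ hd0
    · rintro ⟨a, b⟩ hz
      simp only [Finset.coe_filter, Finset.HasAntidiagonal.mem_antidiagonal, Set.mem_ofPred_eq] at hz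
      simp only [Nat.mul_div_cancel' hz.2.2.1, Prod.mk.injEq, and_true]
      omega
  have hswap : ∑ z ∈ Finset.HasAntidiagonal.antidiagonal n with z.1 < n,
      ((frobFixed F p z.2).filter fun x =>
        minpoly (ZMod p) x ^ (z.2 / (minpoly (ZMod p) x).natDegree) ∣ h).card =
      ∑ x ∈ H.roots.toFinset, H.rootMultiplicity x := by
    simp only [← hcount, Finset.card_eq_sum_ones]
    refine Finset.sum_comm' ?_
    rintro ⟨a, b⟩ x
    simp only [Finset.mem_filter, Finset.HasAntidiagonal.mem_antidiagonal, Multiset.mem_toFinset,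
      mem_roots hH0]
    constructor
    · rintro ⟨⟨h1, h2⟩, h3, h4⟩
      rw [mem_frobFixed (by omega), pow_char_pow_eq_self_iff] at h3
      refine ⟨⟨h1, h2, h3, h4⟩, ?_⟩
      rw [← rootMultiplicity_pos hH0]
      have := (minpoly_pow_dvd_iff hh).1 h4
      exact (Nat.div_pos (Nat.le_of_dvd (by omega) h3) (hdeg x)).trans_le this
    · rintro ⟨⟨h1, h2, h3, h4⟩, -⟩
      refine ⟨⟨h1, h2⟩, ?_, h4⟩
      rwa [mem_frobFixed (by omega), pow_char_pow_eq_self_iff]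
  rw [hswap]
  simp only [← count_roots]
  rw [Multiset.toFinset_sum_count_eq, ← (IsAlgClosed.splits H).natDegree_eq_card_roots, hH,
    natDegree_map, hn]

theorem natCast_mul_rootCharSum (n : ℕ) :
    (n : ℂ) * rootCharSum Ψ A Q n = ∑ z ∈ Finset.HasAntidiagonal.antidiagonal n with z.1 < n,
      rootCharSum Ψ A Q z.1 * expSum Ψ A Q z.2 := by
  classical
  let P : F → ℕ → (ZMod p)[X] := fun x m =>
    minpoly (ZMod p) x ^ (m / (minpoly (ZMod p) x).natDegree)
  have hmonic : ∀ x m, (P x m).Monic := fun x m =>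
    (minpoly.monic (Algebra.IsIntegral.isIntegral x)).pow _
  have hmul : ∀ z : ℕ × ℕ, z.1 + z.2 = n → z.1 < n → ∀ x ∈ frobFixed F p z.2,
      ∑ h ∈ monicsOfDegree (ZMod p) n with P x z.2 ∣ h, rootChar Ψ A Q h =
        rootChar Ψ A Q (P x z.2) * rootCharSum Ψ A Q z.1 := by
    rintro ⟨a, m⟩ hz hlt x hx
    dsimp only at *
    have hdeg : (P x m).natDegree = m := by
      rw [mem_frobFixed (by omega), pow_char_pow_eq_self_iff] at hx
      rw [natDegree_pow, Nat.div_mul_cancel hx]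
    rw [rootCharSum, Finset.mul_sum]
    symm
    refine Finset.sum_bij (fun h _ => P x m * h) ?_ ?_ ?_ ?_
    · intro h hh
      rw [mem_monicsOfDegree] at hh
      rw [Finset.mem_filter, mem_monicsOfDegree, (hmonic x m).natDegree_mul hh.1]
      exact ⟨⟨(hmonic x m).mul hh.1, by omega⟩, dvd_mul_right _ _⟩
    · intro h _ h' _ heq
      exact mul_left_cancel₀ (hmonic x m).ne_zero heq
    · intro h hh
      rw [Finset.mem_filter, mem_monicsOfDegree] at hh
      obtain ⟨⟨h1, h2⟩, k, rfl⟩ := hh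
      have hk := (hmonic x m).of_mul_monic_left h1
      refine ⟨k, ?_, rfl⟩
      rw [(hmonic x m).natDegree_mul hk] at h2
      rw [mem_monicsOfDegree]
      exact ⟨hk, by omega⟩
    · intro h hh
      rw [mem_monicsOfDegree] at hh
      rw [rootChar_mul ((hmonic x m).mul hh.1).ne_zero]
  have hexp : ∀ m ≠ 0, expSum Ψ A Q m = ∑ x ∈ frobFixed F p m, rootChar Ψ A Q (P x m) := by
    intro m hm
    rw [expSum, Finset.sum_filter]
    refine Finset.sum_congr rfl fun x hx => ?_
    rw [rootChar_minpoly_pow hm ((mem_frobFixed hm).1 hx)]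
  calc (n : ℂ) * rootCharSum Ψ A Q n
      = ∑ h ∈ monicsOfDegree (ZMod p) n,
        ∑ z ∈ Finset.HasAntidiagonal.antidiagonal n with z.1 < n,
        ∑ x ∈ frobFixed F p z.2, if P x z.2 ∣ h then rootChar Ψ A Q h else 0 := by
        rw [rootCharSum, Finset.mul_sum]
        refine Finset.sum_congr rfl fun h hh => ?_
        rw [mem_monicsOfDegree] at hh
        conv_lhs => rw [← sum_card_minpoly_pow_dvd (F := F) hh.1.ne_zero hh.2]
        rw [Nat.cast_sum, Finset.sum_mul]
        refine Finset.sum_congr rfl fun z _ => ?_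
        rw [← Finset.sum_filter, Finset.sum_const, nsmul_eq_mul]
    _ = ∑ z ∈ Finset.HasAntidiagonal.antidiagonal n with z.1 < n,
        ∑ x ∈ frobFixed F p z.2, rootChar Ψ A Q (P x z.2) * rootCharSum Ψ A Q z.1 := by
        rw [Finset.sum_comm]
        refine Finset.sum_congr rfl fun z hz => ?_
        rw [Finset.mem_filter, Finset.HasAntidiagonal.mem_antidiagonal] at hz
        rw [Finset.sum_comm]
        refine Finset.sum_congr rfl fun x hx => ?_
        rw [← hmul z hz.1 hz.2 x hx, Finset.sum_filter]
    _ = _ := by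
        refine Finset.sum_congr rfl fun z hz => ?_
        rw [Finset.mem_filter, Finset.HasAntidiagonal.mem_antidiagonal] at hz
        rw [hexp z.2 (by omega), mul_comm, Finset.sum_mul]

end Recurrence

section Vanishing

variable {F : Type*} [Field F] [IsAlgClosed F]

/-- Partial fraction expansion of `A / Q` when `Q` has simple roots and `deg A ≤ deg Q + 1`. -/
theorem exists_div_eq_partial_fractions [DecidableEq F] {A Q : F[X]} (hQ : Q.Separable)
    (hA : A.natDegree ≤ Q.natDegree + 1) :
    ∃ b e : F, ∀ x, Q.eval x ≠ 0 → A.eval x / Q.eval x = b * x + e +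
      ∑ α ∈ Q.roots.toFinset, A.eval α / (derivative Q).eval α * (x - α)⁻¹ := by
  have hQ0 : Q ≠ 0 := hQ.ne_zero
  have hdm := EuclideanDomain.div_add_mod A Q
  have hdiv : (A / Q).natDegree ≤ 1 := by
    by_cases h : A / Q = 0
    · simp [h]
    · have h1 : (Q * (A / Q)).natDegree ≤ A.natDegree := by
        have hne : ¬ A.degree < Q.degree := fun hlt => h ((Polynomial.div_eq_zero_iff hQ0).2 hlt)
        have := degree_add_div hQ0 (not_lt.1 hne)
        rw [← degree_mul] at this
        exact (natDegree_eq_of_degree_eq this).le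
      rw [natDegree_mul hQ0 h] at h1
      omega
  refine ⟨(A / Q).coeff 1, (A / Q).coeff 0, fun x hx => ?_⟩
  have hs : Multiset.card Q.roots = Q.natDegree := (IsAlgClosed.splits Q).natDegree_eq_card_roots.symm
  have hnodup := nodup_roots hQ
  set s := Q.roots.toFinset with hsdef
  have hscard : s.card = Q.natDegree := by rw [← hs, Multiset.toFinset_card_of_nodup hnodup]
  have hQs : Q = C Q.leadingCoeff * Lagrange.nodal s id := by
    conv_lhs => rw [← C_leadingCoeff_mul_prod_multiset_X_sub_C hs]
    rw [Lagrange.nodal, Finset.prod, hsdef, Multiset.toFinset_val, hnodup.dedup]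
    rfl
  have hlc : Q.leadingCoeff ≠ 0 := leadingCoeff_ne_zero.2 hQ0
  have hmod : (A % Q).degree < s.card := by
    rw [hscard, ← degree_eq_natDegree hQ0]
    exact degree_mod_lt A hQ0
  have hroot : ∀ α ∈ s, Q.eval α = 0 := fun α hα => by
    rw [hsdef, Multiset.mem_toFinset, mem_roots hQ0] at hα
    exact hα
  have hxs : ∀ α ∈ s, x ≠ id α := by
    rintro α hα rfl
    exact hx (hroot _ hα)
  have hR := congrArg (eval x) (Lagrange.eq_interpolate (v := id) (Function.injective_id.injOn) hmod)
  rw [Lagrange.eval_interpolate_not_at_node _ hxs] at hR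
  have hAx := congrArg (eval x) hdm
  rw [eval_add, eval_mul, hR, eq_X_add_C_of_natDegree_le_one hdiv] at hAx
  simp only [eval_add, eval_mul, eval_C, eval_X] at hAx
  have hQx : Q.eval x = Q.leadingCoeff * (Lagrange.nodal s id).eval x := by
    conv_lhs => rw [hQs]
    simp
  have hnx : (Lagrange.nodal s id).eval x ≠ 0 := fun h => hx (by rw [hQx, h, mul_zero])
  have hsum : ∑ α ∈ s, A.eval α / (derivative Q).eval α * (x - α)⁻¹ =
      Q.leadingCoeff⁻¹ * ∑ i ∈ s, Lagrange.nodalWeight s id i * (x - id i)⁻¹ *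
        eval (id i) (A % Q) := by
    rw [Finset.mul_sum]
    refine Finset.sum_congr rfl fun α hα => ?_
    have h1 : A.eval α = (A % Q).eval α := by
      conv_lhs => rw [← hdm]
      simp [hroot α hα]
    have h2 : (derivative Q).eval α =
        Q.leadingCoeff * (derivative (Lagrange.nodal s id)).eval α := by
      conv_lhs => rw [hQs]
      simp
    rw [h1, h2, Lagrange.nodalWeight_eq_eval_derivative_nodal hα]
    simp only [id]
    rw [div_eq_mul_inv, mul_inv]
    ring
  rw [hsum, ← hAx, hQx]
  field_simp

variable {p : ℕ} [Fact p.Prime] [Algebra (ZMod p) F]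

theorem exists_rootSum_eq [DecidableEq F] {A Q : (ZMod p)[X]} (hQ : Q.Separable)
    (hA : A.natDegree ≤ Q.natDegree + 1) :
    ∃ b e : F, ∀ h : (ZMod p)[X], h.Monic → IsCoprime h Q →
      rootSum F A Q h = -b * algebraMap (ZMod p) F h.nextCoeff + h.natDegree * e -
        ∑ α ∈ (Q.aroots F).toFinset,
          aeval α A / aeval α (derivative Q) * (aeval α (derivative h) / aeval α h) := by
  obtain ⟨b, e, hbe⟩ := exists_div_eq_partial_fractions (F := F)
    (A := A.map (algebraMap (ZMod p) F)) (Q := Q.map (algebraMap (ZMod p) F)) hQ.map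
    (by simpa only [natDegree_map])
  refine ⟨b, e, fun h hh hcop => ?_⟩
  simp only [derivative_map, eval_map_algebraMap] at hbe
  have hne : ∀ x : F, aeval x h = 0 → aeval x Q ≠ 0 := by
    intro x hx hx'
    obtain ⟨u, v, huv⟩ := hcop
    have := congrArg (aeval x) huv
    simp [hx, hx'] at this
  set H := h.map (algebraMap (ZMod p) F) with hH
  have hHm : H.Monic := hh.map _
  have hroots : ∀ x ∈ h.aroots F, aeval x h = 0 := fun x hx => (mem_aroots.1 hx).2
  have hcard : Multiset.card (h.aroots F) = h.natDegree := by
    rw [aroots_def, ← (IsAlgClosed.splits _).natDegree_eq_card_roots, natDegree_map]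
  rw [rootSum, Multiset.map_congr rfl fun x hx => hbe x (hne x (hroots x hx)), Multiset.sum_map_add,
    Multiset.sum_map_add, Multiset.sum_map_mul_left, Multiset.map_id', Multiset.map_const',
    Multiset.sum_replicate, hcard, nsmul_eq_mul]
  have hnext := (IsAlgClosed.splits H).nextCoeff_eq_neg_sum_roots_of_monic hHm
  rw [hH, nextCoeff_map (algebraMap (ZMod p) F).injective] at hnext
  rw [hnext, aroots_def, sub_eq_add_neg, neg_mul_neg]
  congr 1
  simp only [Finset.sum_eq_multiset_sum]
  rw [Multiset.sum_map_sum_map, ← Finset.sum_eq_multiset_sum, ← Finset.sum_eq_multiset_sum,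
    ← Finset.sum_neg_distrib]
  refine Finset.sum_congr rfl fun α hα => ?_
  have hαQ : aeval α Q = 0 := (mem_aroots.1 (Multiset.mem_toFinset.1 hα)).2
  have hαh : H.eval α ≠ 0 := by
    rw [hH, eval_map_algebraMap]
    exact fun h0 => hne α h0 hαQ
  have hlog := (IsAlgClosed.splits H).eval_derivative_div_eval_of_ne_zero hαh
  rw [Multiset.sum_map_mul_left, ← mul_neg]
  congr 1
  rw [hH, derivative_map, eval_map_algebraMap, eval_map_algebraMap] at hlog
  rw [hlog, ← Multiset.sum_map_neg]
  refine congrArg _ (Multiset.map_congr rfl fun x _ => ?_)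
  rw [one_div, ← inv_neg, neg_sub]

theorem rootCharSum_eq_zero [CharP F p] {Ψ : AddChar F ℂ}
    (hΨ : ∀ j : ZMod p, Ψ (algebraMap (ZMod p) F j) = ZMod.stdAddChar j) {A Q : (ZMod p)[X]}
    (hQ : Squarefree Q) (hQ1 : 1 ≤ Q.natDegree) (hQp : Q.natDegree < p) (hAQ : IsCoprime A Q)
    (hA : A.natDegree ≤ Q.natDegree + 1) {n : ℕ} (hn : 2 * Q.natDegree < n) :
    rootCharSum Ψ A Q n = 0 := by
  classical
  have hsep : Q.Separable := PerfectField.separable_iff_squarefree.2 hQ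
  have hQ0 : Q ≠ 0 := hQ.ne_zero
  obtain ⟨b, e, hbe⟩ := exists_rootSum_eq (F := F) hsep hA
  obtain ⟨U, W, hUW⟩ := hAQ
  let v : (ZMod p)[X] → (ZMod p)[X] := fun h => (h * U) % Q
  have hvdeg : ∀ h, (Q * v h).degree < (n - 1 : ℕ) := by
    intro h
    refine (degree_le_natDegree).trans_lt ?_
    have h1 : (v h).natDegree < Q.natDegree := natDegree_mod_lt _ (by omega)
    have h2 := natDegree_mul_le (p := Q) (q := v h)
    exact_mod_cast (by omega : (Q * v h).natDegree < n - 1)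
  have hvadd : ∀ h k, v (h + Q * k) = v h := by
    intro h k
    refine Polynomial.mod_eq_of_dvd_sub ⟨k * U, ?_⟩
    ring
  have hmem : ∀ h ∈ monicsOfDegree (ZMod p) n, ∀ k : (ZMod p)[X], k.degree < (n - 1 : ℕ) →
      h + k ∈ monicsOfDegree (ZMod p) n ∧ (h + k).nextCoeff = h.nextCoeff := by
    intro h hh k hk
    rw [mem_monicsOfDegree] at hh ⊢
    have hhd : h.degree = n := by rw [degree_eq_natDegree hh.1.ne_zero, hh.2]
    have hlt : k.degree < h.degree := by
      rw [hhd]; exact hk.trans_le (by exact_mod_cast Nat.sub_le n 1)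
    have hd : (h + k).natDegree = n := by
      rw [natDegree_add_eq_left_of_degree_lt hlt, hh.2]
    refine ⟨⟨hh.1.add_of_left hlt, hd⟩, ?_⟩
    rw [nextCoeff_of_natDegree_pos (by omega), nextCoeff_of_natDegree_pos (by omega), hd, hh.2,
      coeff_add, coeff_eq_zero_of_degree_lt hk, add_zero]
  have hcard : (Q.aroots F).toFinset.card = Q.natDegree := by
    rw [aroots_def, Multiset.toFinset_card_of_nodup (nodup_roots hsep.map),
      ← (IsAlgClosed.splits _).natDegree_eq_card_roots, natDegree_map]
  have hshift : ∀ h ∈ monicsOfDegree (ZMod p) n,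
      rootChar Ψ A Q (h + Q * v h) = Ψ (-(Q.natDegree : F)) * rootChar Ψ A Q h := by
    intro h hh
    have hcop : IsCoprime (h + Q * v h) Q ↔ IsCoprime h Q := IsCoprime.add_mul_left_left_iff
    by_cases hc : IsCoprime h Q
    · obtain ⟨h1, h2⟩ := hmem h hh _ (hvdeg h)
      rw [mem_monicsOfDegree] at h1 hh
      rw [rootChar, rootChar, if_pos hc, if_pos (hcop.2 hc), ← AddChar.map_add_eq_mul,
        hbe _ h1.1 (hcop.2 hc), hbe _ hh.1 hc, h2, h1.2, hh.2]
      congr 1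
      have hsum : ∀ α ∈ (Q.aroots F).toFinset,
          aeval α A / aeval α (derivative Q) *
            (aeval α (derivative (h + Q * v h)) / aeval α (h + Q * v h)) =
          aeval α A / aeval α (derivative Q) * (aeval α (derivative h) / aeval α h) + 1 := by
        intro α hα
        have hαQ : aeval α Q = 0 := (mem_aroots.1 (Multiset.mem_toFinset.1 hα)).2
        have hαQ' : aeval α (derivative Q) ≠ 0 := hsep.aeval_derivative_ne_zero hαQ
        have hαh : aeval α h ≠ 0 := by
          intro h0
          obtain ⟨u, w, huw⟩ := hc
          have := congrArg (aeval α) huw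
          simp [h0, hαQ] at this
        have hUA : aeval α U * aeval α A = 1 := by
          have := congrArg (aeval α) hUW
          simpa [hαQ] using this
        have hv : aeval α (v h) = aeval α h * aeval α U := by
          have := congrArg (aeval α) (EuclideanDomain.div_add_mod (h * U) Q)
          simpa [hαQ] using this
        simp only [derivative_mul, map_add, map_mul, hαQ, zero_mul, add_zero, hv]
        field_simp
        linear_combination aeval α (derivative Q) * aeval α h * hUA
      rw [Finset.sum_congr rfl hsum, Finset.sum_add_distrib, Finset.sum_const, hcard, nsmul_eq_mul]
      ring
    · rw [rootChar, rootChar, if_neg hc, if_neg fun h => hc (hcop.1 h), mul_zero]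
  have hΨne : Ψ (-(Q.natDegree : F)) ≠ 1 := by
    have h1 := hΨ (-(Q.natDegree : ZMod p))
    rw [map_neg, map_natCast] at h1
    rw [h1, Ne, ← AddChar.map_zero_eq_one (ZMod.stdAddChar (N := p)),
      ZMod.injective_stdAddChar.eq_iff, neg_eq_zero, ZMod.natCast_eq_zero_iff]
    exact Nat.not_dvd_of_pos_of_lt hQ1 hQp
  have hsum : rootCharSum Ψ A Q n = Ψ (-(Q.natDegree : F)) * rootCharSum Ψ A Q n := by
    conv_rhs => rw [rootCharSum, Finset.mul_sum, ← Finset.sum_congr rfl hshift]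
    symm
    refine Finset.sum_nbij' (fun h => h + Q * v h) (fun h => h - Q * v h) ?_ ?_ ?_ ?_ ?_
    · intro h hh
      exact (hmem h hh _ (hvdeg h)).1
    · intro h hh
      rw [sub_eq_add_neg]
      exact (hmem h hh _ (by rw [degree_neg]; exact hvdeg h)).1
    · intro h _
      rw [hvadd]; ring
    · intro h _
      have := hvadd h (-v h)
      rw [mul_neg, ← sub_eq_add_neg] at this
      rw [this]; ring
    · intro h _
      rfl
  by_contra h0
  exact hΨne (mul_right_cancel₀ h0 (by rw [← hsum, one_mul]))

end Vanishing

/-- Weil's bound for exponential sums of rational functions over a prime field. -/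
theorem norm_sum_stdAddChar_le {p : ℕ} [Fact p.Prime] (hp : 3 ≤ p) {A Q : (ZMod p)[X]}
    (hQ : Squarefree Q) (hQ1 : 1 ≤ Q.natDegree) (hQp : Q.natDegree < p) (hAQ : IsCoprime A Q)
    (hA : A.natDegree ≤ Q.natDegree + 1) :
    ‖∑ x : ZMod p with Q.eval x ≠ 0, ZMod.stdAddChar (A.eval x / Q.eval x)‖ ≤
      2 * Q.natDegree * √p := by
  classical
  let F := AlgebraicClosure (ZMod p)
  have : CharP F p := charP_of_injective_algebraMap (algebraMap (ZMod p) F).injective p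
  obtain ⟨τ, hτ⟩ := LinearMap.exists_leftInverse_of_injective (Algebra.linearMap (ZMod p) F)
    (LinearMap.ker_eq_bot.2 (algebraMap (ZMod p) F).injective)
  let Ψ : AddChar F ℂ := (ZMod.stdAddChar (N := p)).compAddMonoidHom τ.toAddMonoidHom
  have hΨ : ∀ j : ZMod p, Ψ (algebraMap (ZMod p) F j) = ZMod.stdAddChar j := by
    intro j
    exact congrArg ZMod.stdAddChar (LinearMap.congr_fun hτ j)
  obtain ⟨C, N, hN, hC⟩ := norm_expSum_le hp Ψ hΨ hQ hQ1 hAQ hA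
  have key := norm_le_of_newton (D := 2 * Q.natDegree) (a := rootCharSum Ψ A Q)
    (S := expSum Ψ A Q) rootCharSum_zero
    (fun n hn => rootCharSum_eq_zero hΨ hQ hQ1 hQp hAQ hA hn) natCast_mul_rootCharSum
    (q := p) (by exact_mod_cast (by omega : 0 < p)) hN hC
  have h1 : expSum Ψ A Q 1 =
      ∑ x : ZMod p with Q.eval x ≠ 0, ZMod.stdAddChar (A.eval x / Q.eval x) := by
    rw [expSum]
    symm
    refine Finset.sum_bij (fun x _ => algebraMap (ZMod p) F x) ?_ ?_ ?_ ?_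
    · intro x hx
      rw [Finset.mem_filter] at hx ⊢
      rw [mem_frobFixed one_ne_zero, pow_one, ← map_pow, ZMod.pow_card, aeval_algebraMap_apply]
      exact ⟨rfl, (_root_.map_ne_zero _).2 (by simpa using hx.2)⟩
    · intro x _ y _ h
      exact (algebraMap (ZMod p) F).injective h
    · intro y hy
      rw [Finset.mem_filter, mem_frobFixed one_ne_zero, pow_one] at hy
      obtain ⟨x, rfl⟩ := mem_range_algebraMap_of_pow_eq hy.1
      refine ⟨x, ?_, rfl⟩
      rw [aeval_algebraMap_apply] at hy
      simpa using hy.2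
    · intro x _
      rw [← hΨ]
      simp [frobTrace, aeval_algebraMap_apply]
  rw [← h1]
  exact_mod_cast key

section ShiftedInverses

variable {p : ℕ} [Fact p.Prime] {E : Type*} [Field E] [Algebra (ZMod p) E] {k : ℕ}

/-- If a combination of `k` distinct translates of a polynomial of degree at least `k - 1` and
less than `p` vanishes, then all its coefficients do. -/
theorem eq_zero_of_sum_mul_taylor_eq_zero {C₀ : E[X]} (hC : C₀.natDegree < p)
    (hk : k ≤ C₀.natDegree + 1) (hC0 : C₀ ≠ 0) {a d : Fin k → E} (hd : Function.Injective d)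
    (h : ∑ i, C (a i) * taylor (d i) C₀ = 0) : a = 0 := by
  have : CharP E p := charP_of_injective_algebraMap (algebraMap (ZMod p) E).injective p
  set m := C₀.natDegree with hm
  have hcoeff : ∀ n, ∑ i, a i * (hasseDeriv n C₀).eval (d i) = 0 := by
    intro n
    have := congrArg (fun P => coeff P n) h
    simpa [finsetSum_coeff, taylor_coeff] using this
  have hmom : ∀ j, j < k → ∑ i, a i * d i ^ j = 0 := by
    intro j
    induction j using Nat.strong_induction_on with
    | _ j ih =>
      intro hj
      have h1 := hcoeff (m - j)
      have hdeg : (hasseDeriv (m - j) C₀).natDegree < j + 1 := by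
        refine lt_of_le_of_lt (natDegree_hasseDeriv_le _ _) ?_
        omega
      simp_rw [eval_eq_sum_range' hdeg, Finset.mul_sum] at h1
      rw [Finset.sum_comm, Finset.sum_range_succ, Finset.sum_eq_zero, zero_add] at h1
      · have h2 : (hasseDeriv (m - j) C₀).coeff j * ∑ i, a i * d i ^ j = 0 := by
          rw [← h1, Finset.mul_sum]
          exact Finset.sum_congr rfl fun i _ => by ring
        refine (mul_eq_zero.1 h2).resolve_left ?_
        rw [hasseDeriv_coeff, show j + (m - j) = m by omega]
        refine mul_ne_zero ?_ (by simpa [hm] using hC0)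
        rw [Ne, CharP.cast_eq_zero_iff E p]
        exact (Nat.Prime.coprime_iff_not_dvd Fact.out).1
          ((Fact.out : p.Prime).coprime_choose_of_lt hC (by omega))
      · intro l hl
        rw [Finset.mem_range] at hl
        have h2 : (hasseDeriv (m - j) C₀).coeff l * ∑ i, a i * d i ^ l = 0 := by
          rw [ih l hl (by omega), mul_zero]
        rw [← h2, Finset.mul_sum]
        exact Finset.sum_congr rfl fun i _ => by ring
  exact Matrix.eq_zero_of_forall_pow_sum_mul_pow_eq_zero hd fun i => hmom i i.2

/-- The inverses of the values of `f` at fewer than `p - deg f + 2` distinct translates by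
elements of the prime field satisfy no translation invariant linear relation. -/
theorem eq_zero_of_sum_mul_inv_aeval_eq_zero {f : (ZMod p)[X]} (hf : 1 ≤ f.natDegree) {x : E}
    (hx : ∀ t : ZMod p, aeval (x + algebraMap (ZMod p) E t) f ≠ 0) {a d : Fin k → ZMod p}
    (hd : Function.Injective d) (hk : k + f.natDegree ≤ p)
    (h : ∀ t, ∑ i, algebraMap (ZMod p) E (a i) *
      (aeval (x + algebraMap (ZMod p) E (t + d i)) f)⁻¹ = 0) : a = 0 := by
  classical
  have hp := (Fact.out : p.Prime).pos
  have hinj := (algebraMap (ZMod p) E).injective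
  let v : ZMod p → E := algebraMap (ZMod p) E
  have hv : Set.InjOn v (Finset.univ : Finset (ZMod p)) := hinj.injOn
  let C₀ : E[X] := Lagrange.interpolate Finset.univ v fun t => (aeval (x + v t) f)⁻¹
  have hC₀ : ∀ t, C₀.eval (v t) = (aeval (x + v t) f)⁻¹ := fun t =>
    Lagrange.eval_interpolate_at_node _ hv (Finset.mem_univ t)
  have hcard : (Finset.univ : Finset (ZMod p)).card = p := by simp [ZMod.card]
  have hdeg : C₀.degree < (p : ℕ) := by
    have := Lagrange.degree_interpolate_lt (r := fun t => (aeval (x + v t) f)⁻¹) hv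
    rwa [hcard] at this
  have hzero : ∀ P : E[X], P.degree < (p : ℕ) → (∀ t : ZMod p, P.eval (v t) = 0) → P = 0 := by
    intro P hP h0
    exact Polynomial.eq_zero_of_degree_lt_of_eval_index_eq_zero Finset.univ hv (by rwa [hcard]) fun t _ => h0 t
  let G : E[X] := taylor x (f.map (algebraMap (ZMod p) E))
  have hG : ∀ t, G.eval (v t) = aeval (x + v t) f := by
    intro t
    simp [G, taylor_eval, eval_map_algebraMap, add_comm]
  have hGdeg : G.natDegree = f.natDegree := by simp [G, natDegree_taylor]
  have hC0 : C₀ ≠ 0 := by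
    intro h0
    have := hC₀ 0
    rw [h0, eval_zero] at this
    exact hx 0 (inv_eq_zero.1 this.symm)
  have hClt : C₀.natDegree < p := (natDegree_lt_iff_degree_lt hC0).2 hdeg
  have hCge : p ≤ f.natDegree + C₀.natDegree := by
    by_contra! hlt
    have h1 : G * C₀ - 1 = 0 := by
      refine hzero _ ?_ ?_
      · refine lt_of_le_of_lt (degree_sub_le _ _) (max_lt ?_ ?_)
        · refine lt_of_le_of_lt degree_le_natDegree ?_
          refine Nat.cast_lt.2 (lt_of_le_of_lt natDegree_mul_le ?_)
          rwa [hGdeg]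
        · rw [degree_one]
          exact_mod_cast hp
      · intro t
        rw [eval_sub, eval_mul, hG, hC₀, eval_one, mul_inv_cancel₀ (hx t), sub_self]
    have h2 : IsUnit G := IsUnit.of_mul_eq_one _ (sub_eq_zero.1 h1)
    have := natDegree_eq_zero_of_isUnit h2
    omega
  have h0 : ∑ i, C (v (a i)) * taylor (v (d i)) C₀ = 0 := by
    refine hzero _ ?_ ?_
    · refine mem_degreeLT.1 (Submodule.sum_mem _ fun i _ => mem_degreeLT.2 ?_)
      refine lt_of_le_of_lt degree_le_natDegree (Nat.cast_lt.2 ?_)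
      refine lt_of_le_of_lt (natDegree_C_mul_le _ _) ?_
      rwa [natDegree_taylor]
    · intro t
      rw [← h t, eval_finsetSum]
      refine Finset.sum_congr rfl fun i _ => ?_
      rw [eval_mul, eval_C, taylor_eval, ← map_add, hC₀]
  have := eq_zero_of_sum_mul_taylor_eq_zero hClt (by omega) hC0
    (a := fun i => v (a i)) (d := fun i => v (d i)) (hinj.comp hd) h0
  funext i
  exact hinj ((congrFun this i).trans (map_zero _).symm)

end ShiftedInverses

section TranslateSums

variable {p : ℕ} [Fact p.Prime] {k : ℕ}

/-- The numerator of `∑ aᵢ / f(X + dᵢ)` over the common denominator `∏ f(X + dᵢ)` does not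
vanish. -/
theorem sum_mul_prod_taylor_ne_zero {f : (ZMod p)[X]} (hf : 1 ≤ f.natDegree)
    {a d : Fin k → ZMod p} (hd : Function.Injective d) (hk : k + f.natDegree ≤ p) (ha : a ≠ 0) :
    ∑ i, C (a i) * ∏ j ∈ Finset.univ.erase i, taylor (d j) f ≠ 0 := by
  intro h
  have hf0 : f ≠ 0 := by rintro rfl; simp at hf
  let E := FractionRing (ZMod p)[X]
  have hinj : Function.Injective (algebraMap (ZMod p)[X] E) := IsFractionRing.injective _ _
  have hval : ∀ t : ZMod p, aeval (algebraMap (ZMod p)[X] E X + algebraMap (ZMod p) E t) f =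
      algebraMap (ZMod p)[X] E (taylor t f) := by
    intro t
    rw [IsScalarTower.algebraMap_apply (ZMod p) (ZMod p)[X] E, ← map_add,
      aeval_algebraMap_apply, taylor_apply]
    rfl
  have hne : ∀ t : ZMod p, algebraMap (ZMod p)[X] E (taylor t f) ≠ 0 := by
    intro t h0
    exact hf0 (taylor_injective t (hinj (h0.trans (by simp))))
  refine ha (eq_zero_of_sum_mul_inv_aeval_eq_zero hf (x := algebraMap (ZMod p)[X] E X)
    (fun t => by rw [hval]; exact hne t) hd hk fun t => ?_)
  have h1 := congrArg (fun P => algebraMap (ZMod p)[X] E (taylor t P)) h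
  have hprod : (∏ j, algebraMap (ZMod p)[X] E (taylor (t + d j) f)) ≠ 0 :=
    Finset.prod_ne_zero_iff.2 fun j _ => hne _
  refine mul_left_cancel₀ hprod ?_
  simp only [map_zero, map_sum, taylor_mul, map_mul, taylor_C] at h1
  rw [mul_zero, Finset.mul_sum, ← h1]
  refine Finset.sum_congr rfl fun i _ => ?_
  rw [hval, ← Finset.mul_prod_erase _ _ (Finset.mem_univ i),
    IsScalarTower.algebraMap_apply (ZMod p) (ZMod p)[X] E]
  have h2 : ∏ j ∈ Finset.univ.erase i, algebraMap (ZMod p)[X] E (taylor (t + d j) f) =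
      algebraMap (ZMod p)[X] E (taylor t (∏ j ∈ Finset.univ.erase i, taylor (d j) f)) := by
    rw [← map_prod]
    congr 1
    rw [← taylorAlgHom_apply, map_prod]
    refine Finset.prod_congr rfl fun j _ => ?_
    rw [taylorAlgHom_apply, taylor_taylor, add_comm]
  rw [h2, Polynomial.algebraMap_eq]
  rw [mul_comm (algebraMap (ZMod p)[X] E (C (a i))) (_⁻¹), mul_mul_mul_comm,
    mul_inv_cancel₀ (hne (t + d i)), one_mul, mul_comm]

/-- A proper fraction over a product of squarefree polynomials, written as a sum of multiples of
their inverses, has a reduced form with squarefree denominator. -/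
theorem exists_reduced_fraction {K : Type*} [Field K] {g : Fin k → K[X]}
    (hg : ∀ i, Squarefree (g i)) (hg1 : ∀ i, 1 ≤ (g i).natDegree) {a : Fin k → K}
    (h : ∑ i, C (a i) * ∏ j ∈ Finset.univ.erase i, g j ≠ 0) :
    ∃ P Q : K[X], Squarefree Q ∧ IsCoprime P Q ∧ 1 ≤ Q.natDegree ∧
      P.natDegree < Q.natDegree ∧ Q ∣ ∏ i, g i ∧
      ∀ x, (∀ i, (g i).eval x ≠ 0) → ∑ i, a i / (g i).eval x = P.eval x / Q.eval x := by
  classical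
  set B := ∏ i, g i with hB
  have hg0 : ∀ i, g i ≠ 0 := fun i => (hg i).ne_zero
  have hB0 : B ≠ 0 := Finset.prod_ne_zero_iff.2 fun i _ => hg0 i
  set L := UniqueFactorizationMonoid.radical B with hL
  have hL0 : L ≠ 0 := UniqueFactorizationMonoid.radical_ne_zero
  have hLB : L ∣ B := UniqueFactorizationMonoid.radical_dvd_self
  obtain ⟨W, hW⟩ := hLB
  have hgL : ∀ i, g i ∣ L := fun i =>
    (UniqueFactorizationMonoid.dvd_radical_iff (hg i).isRadical hB0).2
      (Finset.dvd_prod_of_mem _ (Finset.mem_univ i))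
  choose u hu using hgL
  set N := ∑ i, C (a i) * u i with hN
  have hNW : N * W = ∑ i, C (a i) * ∏ j ∈ Finset.univ.erase i, g j := by
    rw [hN, Finset.sum_mul]
    refine Finset.sum_congr rfl fun i _ => ?_
    refine mul_left_cancel₀ (hg0 i) ?_
    have := Finset.mul_prod_erase Finset.univ g (Finset.mem_univ i)
    linear_combination C (a i) * (-hW - W * hu i - this)
  have hN0 : N ≠ 0 := by
    rintro h0
    rw [h0, zero_mul] at hNW
    exact h hNW.symm
  have hu0 : ∀ i, u i ≠ 0 := fun i h0 => hL0 (by rw [hu i, h0, mul_zero])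
  have hNL : N.degree < L.degree := by
    rw [degree_eq_natDegree hL0]
    refine mem_degreeLT.1 (Submodule.sum_mem _ fun i _ => mem_degreeLT.2 ?_)
    refine lt_of_le_of_lt degree_le_natDegree (Nat.cast_lt.2 ?_)
    refine lt_of_le_of_lt (natDegree_C_mul_le _ _) ?_
    have := natDegree_mul (hg0 i) (hu0 i)
    rw [← hu i] at this
    have := hg1 i
    omega
  have hNLn := natDegree_lt_natDegree hN0 hNL
  set G := EuclideanDomain.gcd N L with hG
  have hG0 : G ≠ 0 := fun h0 => hL0 (EuclideanDomain.gcd_eq_zero_iff.1 h0).2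
  obtain ⟨P, hP⟩ := EuclideanDomain.gcd_dvd_left N L
  obtain ⟨Q, hQ⟩ := EuclideanDomain.gcd_dvd_right N L
  rw [← hG] at hP hQ
  have hP0 : P ≠ 0 := by rintro rfl; exact hN0 (by rw [hP, mul_zero])
  have hQ0 : Q ≠ 0 := by rintro rfl; exact hL0 (by rw [hQ, mul_zero])
  have hPQ : P.natDegree < Q.natDegree := by
    rw [hP, hQ, natDegree_mul hG0 hP0, natDegree_mul hG0 hQ0] at hNLn
    omega
  have hcop : IsCoprime P Q := by
    refine ⟨EuclideanDomain.gcdA N L, EuclideanDomain.gcdB N L, ?_⟩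
    refine mul_left_cancel₀ hG0 ?_
    have := EuclideanDomain.gcd_eq_gcd_ab N L
    rw [← hG] at this
    linear_combination -this - EuclideanDomain.gcdA N L * hP - EuclideanDomain.gcdB N L * hQ
  have hQL : Q ∣ L := ⟨G, by rw [hQ, mul_comm]⟩
  refine ⟨P, Q, UniqueFactorizationMonoid.squarefree_radical.squarefree_of_dvd hQL, hcop,
    by omega, hPQ, hQL.trans ⟨W, hW⟩, fun x hx => ?_⟩
  have hBx : B.eval x ≠ 0 := by
    rw [hB, eval_prod]
    exact Finset.prod_ne_zero_iff.2 fun i _ => hx i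
  have hLx : L.eval x ≠ 0 := by
    intro h0
    rw [hW, eval_mul, h0, zero_mul] at hBx
    exact hBx rfl
  have h1 : ∑ i, a i / (g i).eval x = N.eval x / L.eval x := by
    rw [hN, eval_finsetSum, Finset.sum_div]
    refine Finset.sum_congr rfl fun i _ => ?_
    have h2 : (u i).eval x ≠ 0 := by
      intro h0
      rw [hu i, eval_mul, h0, mul_zero] at hLx
      exact hLx rfl
    rw [hu i, eval_mul, eval_mul, eval_C, div_eq_div_iff (hx i) (mul_ne_zero (hx i) h2)]
    ring
  rw [h1]
  have hGx : G.eval x ≠ 0 := by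
    intro h0
    rw [hQ, eval_mul, h0, zero_mul] at hLx
    exact hLx rfl
  rw [hP, hQ, eval_mul, eval_mul, mul_div_mul_left _ _ hGx]

/-- The Weil bound for sums of combinations of inverses of distinct translates of `f`, twisted by
a linear phase. -/
theorem norm_sum_stdAddChar_translates_le (hp : 3 ≤ p) {f : (ZMod p)[X]} (hf : Squarefree f)
    (hf1 : 1 ≤ f.natDegree) {a d : Fin k → ZMod p} (hd : Function.Injective d)
    (hk : 2 * f.natDegree * k < p) (ha : a ≠ 0) (b : ZMod p) :
    ‖∑ x : ZMod p with ∀ i, f.eval (x + d i) ≠ 0,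
      ZMod.stdAddChar (∑ i, a i * (f.eval (x + d i))⁻¹ + b * x)‖ ≤
      3 * (k * f.natDegree) * √p := by
  classical
  have hk0 : 1 ≤ k := by
    rcases k with _ | k
    · exact absurd (Subsingleton.elim _ _) ha
    · omega
  have hkD : k + f.natDegree ≤ p := by nlinarith
  have hev : ∀ x i, (taylor (d i) f).eval x = f.eval (x + d i) := fun x i => by
    rw [taylor_eval]
  have hsq : ∀ i, Squarefree (taylor (d i) f) := fun i => by
    intro y hy
    have h1 := hf (taylor (-d i) y) (by
      have := map_dvd (taylorAlgHom (-d i)) hy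
      simpa [taylorAlgHom_apply, taylor_taylor] using this)
    have := h1.map (taylorAlgHom (d i))
    simpa [taylorAlgHom_apply, taylor_taylor] using this
  obtain ⟨P, Q, hQ, hPQ, hQ1, hdeg, hQB, hval⟩ := exists_reduced_fraction
    (g := fun i => taylor (d i) f) hsq (fun i => by rwa [natDegree_taylor])
    (sum_mul_prod_taylor_ne_zero hf1 hd hkD ha)
  set B := ∏ i, taylor (d i) f with hB
  have hB0 : B ≠ 0 := Finset.prod_ne_zero_iff.2 fun i _ => (hsq i).ne_zero
  have hBdeg : B.natDegree = k * f.natDegree := by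
    rw [hB, natDegree_prod _ _ fun i _ => (hsq i).ne_zero]
    simp
  have hQdeg : Q.natDegree ≤ k * f.natDegree := hBdeg ▸ natDegree_le_of_dvd hQB hB0
  have hBx : ∀ x, (∀ i, f.eval (x + d i) ≠ 0) ↔ B.eval x ≠ 0 := by
    intro x
    rw [hB, eval_prod, Finset.prod_ne_zero_iff]
    simp [hev]
  have hQx : ∀ x, B.eval x ≠ 0 → Q.eval x ≠ 0 := by
    intro x hx h0
    exact hx (eval_eq_zero_of_dvd_of_eval_eq_zero hQB h0)
  let A := P + C b * X * Q
  have hA : A.natDegree ≤ Q.natDegree + 1 := by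
    refine natDegree_add_le_of_degree_le (by omega) ?_
    refine natDegree_mul_le.trans ?_
    have : (C b * X : (ZMod p)[X]).natDegree ≤ 1 := (natDegree_C_mul_le _ _).trans natDegree_X_le
    omega
  have hAQ : IsCoprime A Q := IsCoprime.add_mul_right_left_iff.2 hPQ
  have hweil := norm_sum_stdAddChar_le hp hQ hQ1 (by nlinarith) hAQ hA
  have hterm : ∀ x, (∀ i, f.eval (x + d i) ≠ 0) →
      ∑ i, a i * (f.eval (x + d i))⁻¹ + b * x = A.eval x / Q.eval x := by
    intro x hx
    have h1 := hval x fun i => by rw [hev]; exact hx i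
    have h2 := hQx x ((hBx x).1 hx)
    simp_rw [hev, div_eq_mul_inv] at h1
    rw [h1, eq_div_iff h2]
    simp only [A, eval_add, eval_mul, eval_C, eval_X]
    field_simp
  rw [Finset.sum_congr rfl fun x hx => by rw [hterm x (Finset.mem_filter.1 hx).2]]
  set S := Finset.univ.filter fun x : ZMod p => Q.eval x ≠ 0
  set T := Finset.univ.filter fun x : ZMod p => ∀ i, f.eval (x + d i) ≠ 0
  have hTS : T ⊆ S := by
    intro x hx
    rw [Finset.mem_filter] at hx ⊢
    exact ⟨hx.1, hQx x ((hBx x).1 hx.2)⟩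
  have hcard : ((S \ T).card : ℝ) ≤ k * f.natDegree := by
    have h1 : S \ T ⊆ B.roots.toFinset := by
      intro x hx
      rw [Finset.mem_sdiff, Finset.mem_filter, Finset.mem_filter, hBx] at hx
      rw [Multiset.mem_toFinset, mem_roots hB0]
      by_contra h0
      exact hx.2 ⟨Finset.mem_univ _, h0⟩
    have h2 := (Finset.card_le_card h1).trans
      ((Multiset.toFinset_card_le _).trans (card_roots' B))
    rw [hBdeg] at h2
    exact_mod_cast h2
  have hsplit := Finset.sum_sdiff hTS (f := fun x => ZMod.stdAddChar (A.eval x / Q.eval x))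
  have hsmall : ‖∑ x ∈ S \ T, ZMod.stdAddChar (A.eval x / Q.eval x)‖ ≤ k * f.natDegree := by
    refine (norm_sum_le _ _).trans (le_trans ?_ hcard)
    simp [AddChar.norm_apply]
  have hsqrt : (1 : ℝ) ≤ √p := by
    rw [Real.one_le_sqrt]
    exact_mod_cast (by omega : 1 ≤ p)
  have hQr : (Q.natDegree : ℝ) ≤ k * f.natDegree := by exact_mod_cast hQdeg
  rw [← eq_sub_iff_add_eq'] at hsplit
  rw [hsplit]
  refine (norm_sub_le _ _).trans ?_
  have : 2 * (Q.natDegree : ℝ) * √p ≤ 2 * (k * f.natDegree) * √p := by gcongr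
  have hnn : (0 : ℝ) ≤ k * f.natDegree := by positivity
  nlinarith [mul_le_mul_of_nonneg_left hsqrt hnn]

end TranslateSums

section IntervalFourier

theorem inv_sin_le {x : ℝ} (h0 : 0 < x) (h1 : x ≤ Real.pi / 2) :
    (Real.sin x)⁻¹ ≤ 6 / 5 * x⁻¹ + 6 / 5 := by
  have key : ∀ y : ℝ, 0 < y → y ≤ 1 → 5 / 6 * y ≤ Real.sin y := by
    intro y hy hy1
    have := Real.sin_gt_sub_cube hy
    nlinarith [mul_nonneg hy.le (mul_nonneg (sub_nonneg.2 hy1) (by linarith : 0 ≤ 1 + y))]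
  have hx : 0 < x⁻¹ := inv_pos.2 h0
  rcases le_total x 1 with hx1 | hx1
  · have h2 : (Real.sin x)⁻¹ ≤ (5 / 6 * x)⁻¹ := inv_anti₀ (by positivity) (key x h0 hx1)
    rw [mul_inv] at h2
    norm_num at h2
    linarith
  · have h2 : 5 / 6 ≤ Real.sin x := by
      refine le_trans ?_ (Real.sin_le_sin_of_le_of_le_pi_div_two (by linarith [Real.pi_pos]) h1 hx1)
      simpa using key 1 one_pos le_rfl
    have h3 : (Real.sin x)⁻¹ ≤ (5 / 6)⁻¹ := inv_anti₀ (by positivity) h2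
    norm_num at h3
    linarith

theorem inv_sin_pi_mul_le {x : ℝ} (h0 : 0 < x) (h1 : x < 1) :
    (Real.sin (Real.pi * x))⁻¹ ≤ 2 / 5 * (x⁻¹ + (1 - x)⁻¹) + 6 / 5 := by
  have hpi := Real.pi_gt_three
  have key : ∀ y : ℝ, 0 < y → y ≤ 1 / 2 →
      (Real.sin (Real.pi * y))⁻¹ ≤ 2 / 5 * y⁻¹ + 6 / 5 := by
    intro y hy hy1
    have h2 := inv_sin_le (mul_pos Real.pi_pos hy) (by nlinarith)
    rw [mul_inv] at h2
    have h3 : Real.pi⁻¹ ≤ 3⁻¹ := inv_anti₀ (by norm_num) hpi.le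
    have h4 : Real.pi⁻¹ * y⁻¹ ≤ 3⁻¹ * y⁻¹ :=
      mul_le_mul_of_nonneg_right h3 (inv_pos.2 hy).le
    linarith
  have hx : 0 < x⁻¹ := inv_pos.2 h0
  have hx' : 0 < (1 - x)⁻¹ := inv_pos.2 (by linarith)
  rcases le_total x (1 / 2) with h | h
  · linarith [key x h0 h]
  · have h2 := key (1 - x) (by linarith) (by linarith)
    rw [mul_sub, mul_one, Real.sin_pi_sub] at h2
    linarith

variable {p : ℕ} [Fact p.Prime]

/-- The Fourier coefficients of the interval `{r, …, r + s - 1}` modulo `p`. -/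
noncomputable def intervalCoeff (p : ℕ) [Fact p.Prime] (r : ℤ) (s : ℕ) (a : ZMod p) : ℂ :=
  (p : ℂ)⁻¹ * ∑ j ∈ Finset.range s, ZMod.stdAddChar (N := p) (-(a * (r + (j : ZMod p))))

theorem intervalCoeff_zero (r : ℤ) (s : ℕ) : intervalCoeff p r s 0 = s / p := by
  simp [intervalCoeff, div_eq_inv_mul]

open scoped Classical in
theorem sum_intervalCoeff_mul (r : ℤ) {s : ℕ} (hs : s ≤ p) (u : ZMod p) :
    ∑ a, intervalCoeff p r s a * ZMod.stdAddChar (a * u) =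
      if ∃ h : ℤ, r ≤ h ∧ h < r + s ∧ (h : ZMod p) = u then 1 else 0 := by
  have hp0 : (p : ℂ) ≠ 0 := Nat.cast_ne_zero.2 (Fact.out : p.Prime).ne_zero
  have h1 : ∑ a, intervalCoeff p r s a * ZMod.stdAddChar (a * u) =
      ∑ j ∈ Finset.range s, if (r : ZMod p) + j = u then (1 : ℂ) else 0 := by
    simp_rw [intervalCoeff, mul_assoc, Finset.sum_mul]
    rw [← Finset.mul_sum, Finset.sum_comm, Finset.mul_sum]
    refine Finset.sum_congr rfl fun j _ => ?_
    have h2 := AddChar.sum_mulShift (u - (r + j)) (ZMod.isPrimitive_stdAddChar p)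
    simp_rw [← AddChar.map_add_eq_mul]
    rw [ZMod.card] at h2
    rw [Finset.sum_congr rfl fun a _ => by
      rw [show -(a * ((r : ZMod p) + j)) + a * u = a * (u - (r + j)) by ring], h2]
    by_cases h : (r : ZMod p) + j = u
    · rw [if_pos h, if_pos (by rw [h, sub_self]), inv_mul_cancel₀ hp0]
    · rw [if_neg h, if_neg (fun h' => h (sub_eq_zero.1 h').symm), Nat.cast_zero, mul_zero]
  rw [h1]
  split_ifs with h
  · obtain ⟨h, hr, hs', hu⟩ := h
    obtain ⟨j, hj⟩ := Int.eq_ofNat_of_zero_le (sub_nonneg.2 hr)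
    have hjr : (r : ZMod p) + j = u := by
      rw [← hu, show h = r + j by omega]
      simp
    rw [Finset.sum_eq_single j, if_pos hjr]
    · intro i hi hij
      rw [if_neg]
      intro hir
      have h3 : ((i : ℕ) : ZMod p) = (j : ℕ) := add_left_cancel (hir.trans hjr.symm)
      rw [Finset.mem_range] at hi
      rw [ZMod.natCast_eq_natCast_iff', Nat.mod_eq_of_lt (by omega),
        Nat.mod_eq_of_lt (by omega)] at h3
      exact hij h3
    · intro hj'
      exact absurd (Finset.mem_range.2 (by omega)) hj'
  · refine Finset.sum_eq_zero fun j hj => if_neg fun hju => h ⟨r + j, ?_⟩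
    rw [Finset.mem_range] at hj
    exact ⟨by omega, by omega, by simpa using hju⟩

theorem norm_intervalCoeff_le (r : ℤ) (s : ℕ) {a : ZMod p} (ha : a ≠ 0) :
    ‖intervalCoeff p r s a‖ ≤
      2 / 5 * ((a.val : ℝ)⁻¹ + ((p : ℝ) - a.val)⁻¹) + 6 / 5 * (p : ℝ)⁻¹ := by
  have hp : (0 : ℝ) < p := Nat.cast_pos.2 (Fact.out : p.Prime).pos
  have hv0 : (0 : ℝ) < a.val := Nat.cast_pos.2 (ZMod.val_pos.2 ha)
  have hvp : (a.val : ℝ) < p := Nat.cast_lt.2 a.val_lt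
  set z : ℂ := ZMod.stdAddChar (-a) with hz
  set x : ℝ := a.val / p with hx
  have hx0 : 0 < x := by positivity
  have hx1 : x < 1 := (div_lt_one hp).2 hvp
  have hsin : 0 < Real.sin (Real.pi * x) :=
    Real.sin_pos_of_pos_of_lt_pi (by positivity) (by nlinarith [Real.pi_pos])
  have hz1 : ‖z - 1‖ = 2 * Real.sin (Real.pi * x) := by
    have h1 : z = Complex.exp (Complex.I * ((-(2 * Real.pi * x) : ℝ) : ℂ)) := by
      have : -a = ((-(a.val : ℤ) : ℤ) : ZMod p) := by simp
      rw [hz, this, ZMod.stdAddChar_coe]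
      congr 1
      rw [hx]
      push_cast
      ring
    rw [h1, Complex.norm_exp_I_mul_ofReal_sub_one,
      show -(2 * Real.pi * x) / 2 = -(Real.pi * x) by ring, Real.sin_neg, Real.norm_eq_abs,
      mul_neg, abs_neg, abs_of_pos (by positivity)]
  have hgeom : ‖∑ j ∈ Finset.range s, z ^ j‖ ≤ (Real.sin (Real.pi * x))⁻¹ := by
    have h1 := congrArg norm (geom_sum_mul z s)
    rw [norm_mul, hz1] at h1
    have h2 : ‖z ^ s - 1‖ ≤ 2 := by
      refine (norm_sub_le _ _).trans ?_
      rw [norm_pow, hz, AddChar.norm_apply]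
      norm_num
    rw [← one_div, le_div_iff₀ hsin]
    linarith
  have hsum : ∑ j ∈ Finset.range s, ZMod.stdAddChar (N := p) (-(a * (r + (j : ZMod p)))) =
      ZMod.stdAddChar (N := p) (-(a * r)) * ∑ j ∈ Finset.range s, z ^ j := by
    rw [Finset.mul_sum]
    refine Finset.sum_congr rfl fun j _ => ?_
    rw [hz, ← AddChar.map_nsmul_eq_pow, ← AddChar.map_add_eq_mul, nsmul_eq_mul]
    congr 1
    ring
  rw [intervalCoeff, hsum, norm_mul, norm_mul, AddChar.norm_apply, one_mul, norm_inv,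
    Complex.norm_natCast]
  have h1 := mul_le_mul_of_nonneg_left (hgeom.trans (inv_sin_pi_mul_le hx0 hx1))
    (inv_pos.2 hp).le
  refine h1.trans (le_of_eq ?_)
  have h2 : (p : ℝ) - a.val ≠ 0 := (sub_pos.2 hvp).ne'
  rw [show 1 - x = (p - a.val) / p by rw [hx]; field_simp, hx]
  field_simp

theorem sum_norm_intervalCoeff_le (r : ℤ) (s : ℕ) :
    ∑ a : ZMod p with a ≠ 0, ‖intervalCoeff p r s a‖ ≤ 4 / 5 * Real.log p + 2 := by
  have hp0 := (Fact.out : p.Prime).pos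
  have hp : (0 : ℝ) < p := Nat.cast_pos.2 hp0
  have hcard : (Finset.univ.filter fun a : ZMod p => a ≠ 0).card ≤ p := by
    refine (Finset.card_filter_le _ _).trans ?_
    simp [ZMod.card]
  have hval : ∑ a : ZMod p with a ≠ 0, (a.val : ℝ)⁻¹ ≤ 1 + Real.log p := by
    refine le_trans ?_ (harmonic_le_one_add_log p)
    rw [harmonic]
    push_cast
    have hinj : Set.InjOn (fun a : ZMod p => a.val - 1)
        (Finset.univ.filter fun a : ZMod p => a ≠ 0) := by
      intro a ha b hb hab
      have h1 := ZMod.val_pos.2 (Finset.mem_filter.1 ha).2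
      have h2 := ZMod.val_pos.2 (Finset.mem_filter.1 hb).2
      dsimp only at hab
      exact ZMod.val_injective p (by omega)
    have h1 : ∑ a : ZMod p with a ≠ 0, (a.val : ℝ)⁻¹ =
        ∑ i ∈ (Finset.univ.filter fun a : ZMod p => a ≠ 0).image (fun a => (a.val - 1 : ℕ)),
          (((i : ℕ) : ℝ) + 1)⁻¹ := by
      rw [Finset.sum_image hinj]
      refine Finset.sum_congr rfl fun a ha => ?_
      have h1 := ZMod.val_pos.2 (Finset.mem_filter.1 ha).2
      rw [Nat.cast_sub h1, Nat.cast_one, sub_add_cancel]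
    rw [h1]
    refine Finset.sum_le_sum_of_subset_of_nonneg ?_ fun i _ _ => by positivity
    intro i hi
    obtain ⟨a, _, rfl⟩ := Finset.mem_image.1 hi
    have := a.val_lt
    exact Finset.mem_range.2 (by omega)
  have hneg : ∑ a : ZMod p with a ≠ 0, ((p : ℝ) - a.val)⁻¹ =
      ∑ a : ZMod p with a ≠ 0, (a.val : ℝ)⁻¹ := by
    refine Finset.sum_nbij' (fun a => -a) (fun a => -a) ?_ ?_ ?_ ?_ ?_
    · simp
    · simp
    · simp
    · simp
    · intro a ha
      rw [Finset.mem_filter] at ha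
      have : NeZero a := ⟨ha.2⟩
      rw [ZMod.val_neg_of_ne_zero, Nat.cast_sub a.val_lt.le]
  calc _ ≤ ∑ a : ZMod p with a ≠ 0,
      (2 / 5 * ((a.val : ℝ)⁻¹ + ((p : ℝ) - a.val)⁻¹) + 6 / 5 * (p : ℝ)⁻¹) :=
        Finset.sum_le_sum fun a ha => norm_intervalCoeff_le r s (Finset.mem_filter.1 ha).2
    _ ≤ _ := by
      rw [Finset.sum_add_distrib, ← Finset.mul_sum, Finset.sum_add_distrib, hneg,
        Finset.sum_const, nsmul_eq_mul]
      have h1 : ((Finset.univ.filter fun a : ZMod p => a ≠ 0).card : ℝ) * (6 / 5 * (p : ℝ)⁻¹) ≤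
          p * (6 / 5 * (p : ℝ)⁻¹) := by
        gcongr
      have h2 : (p : ℝ) * (6 / 5 * (p : ℝ)⁻¹) = 6 / 5 := by field_simp
      linarith

end IntervalFourier

section Expansion

variable {p : ℕ} [Fact p.Prime]

/-- Completion of an exponential sum restricted to an initial interval. -/
theorem norm_sum_val_lt_le (T : Finset (ZMod p)) (g : ZMod p → ZMod p) {M : ℕ} (hM : M ≤ p)
    {W : ℝ} (hW : ∀ b, ‖∑ x ∈ T, ZMod.stdAddChar (g x + b * x)‖ ≤ W) :
    ‖∑ x ∈ T with x.val < M, ZMod.stdAddChar (g x)‖ ≤ (4 / 5 * Real.log p + 3) * W := by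
  classical
  have hp : (0 : ℝ) < p := Nat.cast_pos.2 (Fact.out : p.Prime).pos
  have hind : ∀ x : ZMod p, (if x.val < M then (1 : ℂ) else 0) =
      ∑ b, intervalCoeff p 0 M b * ZMod.stdAddChar (b * x) := by
    intro x
    rw [sum_intervalCoeff_mul 0 hM]
    refine if_congr ⟨fun h => ⟨x.val, by omega, by omega, by simp⟩, ?_⟩ rfl rfl
    rintro ⟨h, h0, h1, rfl⟩
    obtain ⟨j, rfl⟩ := Int.eq_ofNat_of_zero_le h0
    rw [Int.cast_natCast, ZMod.val_natCast]
    exact lt_of_le_of_lt (Nat.mod_le _ _) (by omega)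
  have h1 : ∑ x ∈ T with x.val < M, ZMod.stdAddChar (g x) =
      ∑ b, intervalCoeff p 0 M b * ∑ x ∈ T, ZMod.stdAddChar (g x + b * x) := by
    simp_rw [Finset.mul_sum]
    rw [Finset.sum_filter, Finset.sum_comm]
    refine Finset.sum_congr rfl fun x _ => ?_
    rw [← mul_boole, hind, Finset.mul_sum]
    refine Finset.sum_congr rfl fun b _ => ?_
    rw [AddChar.map_add_eq_mul]
    ring
  have h2 : ∑ b, ‖intervalCoeff p 0 M b‖ ≤ 4 / 5 * Real.log p + 3 := by
    rw [← Finset.sum_filter_add_sum_filter_not Finset.univ (fun b : ZMod p => b ≠ 0)]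
    have h3 : ∑ b : ZMod p with ¬ b ≠ 0, ‖intervalCoeff p 0 M b‖ ≤ 1 := by
      have : (Finset.univ.filter fun b : ZMod p => ¬ b ≠ 0) = {0} := by ext; simp
      rw [this, Finset.sum_singleton, intervalCoeff_zero, norm_div, Complex.norm_natCast,
        Complex.norm_natCast, div_le_one hp]
      exact_mod_cast hM
    linarith [sum_norm_intervalCoeff_le (p := p) 0 M]
  have hW0 : 0 ≤ W := (norm_nonneg _).trans (hW 0)
  rw [h1]
  refine (norm_sum_le _ _).trans ?_
  refine le_trans ?_ (mul_le_mul_of_nonneg_right h2 hW0)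
  rw [Finset.sum_mul]
  refine Finset.sum_le_sum fun b _ => ?_
  rw [norm_mul]
  exact mul_le_mul_of_nonneg_left (hW b) (norm_nonneg _)

/-- Bound for sums of products of functions with controlled Fourier expansions. -/
theorem norm_sum_prod_le {k : ℕ} (hk : 0 < k) (T : Finset (ZMod p))
    (u : Fin k → ZMod p → ZMod p) {κ : ZMod p → ℂ} (hκ : ‖κ 0‖ ≤ 1) {L V : ℝ}
    (hL : ∑ a with a ≠ 0, ‖κ a‖ ≤ L)
    (hV : ∀ a : Fin k → ZMod p, a ≠ 0 → ‖∑ x ∈ T, ZMod.stdAddChar (∑ i, a i * u i x)‖ ≤ V)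
    (hV0 : 0 ≤ V) :
    ‖∑ x ∈ T, ∏ i, ∑ a, κ a * ZMod.stdAddChar (a * u i x)‖ ≤
      ‖κ 0‖ * T.card + (L + 1) ^ k * V := by
  classical
  have h1 : ∑ x ∈ T, ∏ i, ∑ a, κ a * ZMod.stdAddChar (a * u i x) =
      ∑ a : Fin k → ZMod p, (∏ i, κ (a i)) * ∑ x ∈ T, ZMod.stdAddChar (∑ i, a i * u i x) := by
    simp_rw [Finset.mul_sum]
    rw [Finset.sum_comm]
    refine Finset.sum_congr rfl fun x _ => ?_
    rw [Finset.prod_univ_sum, Fintype.piFinset_univ]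
    refine Finset.sum_congr rfl fun a _ => ?_
    rw [Finset.prod_mul_distrib]
    congr 1
    exact (map_prod (ZMod.stdAddChar (N := p)).toMonoidHom
      (fun i => Multiplicative.ofAdd (a i * u i x)) Finset.univ).symm
  have h2 : ∑ a : Fin k → ZMod p, ∏ i, ‖κ (a i)‖ ≤ (L + 1) ^ k := by
    have := Finset.prod_univ_sum (fun _ : Fin k => (Finset.univ : Finset (ZMod p)))
      (fun _ a => ‖κ a‖)
    rw [Fintype.piFinset_univ] at this
    rw [← this, Finset.prod_const, Finset.card_univ, Fintype.card_fin]
    refine pow_le_pow_left₀ (Finset.sum_nonneg fun _ _ => norm_nonneg _) ?_ k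
    rw [← Finset.sum_filter_add_sum_filter_not Finset.univ (fun b : ZMod p => b ≠ 0)]
    have h3 : (Finset.univ.filter fun b : ZMod p => ¬ b ≠ 0) = {0} := by ext; simp
    rw [h3, Finset.sum_singleton]
    exact add_le_add hL hκ
  rw [h1, ← Finset.add_sum_erase _ _ (Finset.mem_univ (0 : Fin k → ZMod p))]
  refine (norm_add_le _ _).trans (add_le_add ?_ ?_)
  · simp only [Pi.zero_apply, zero_mul, Finset.sum_const_zero, AddChar.map_zero_eq_one,
      Finset.prod_const, Finset.card_univ, Fintype.card_fin, Finset.sum_const, nsmul_eq_mul,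
      mul_one, norm_mul, norm_pow, Complex.norm_natCast]
    refine mul_le_mul_of_nonneg_right ?_ (Nat.cast_nonneg _)
    exact pow_le_of_le_one (norm_nonneg _) hκ hk.ne'
  · refine (norm_sum_le _ _).trans ?_
    refine le_trans ?_ (mul_le_mul_of_nonneg_right h2 hV0)
    rw [Finset.sum_mul]
    refine le_trans (Finset.sum_le_sum fun a ha => ?_)
      (Finset.sum_le_sum_of_subset_of_nonneg (Finset.erase_subset _ _) fun a _ _ =>
        mul_nonneg (Finset.prod_nonneg fun _ _ => norm_nonneg _) hV0)
    rw [norm_mul, norm_prod]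
    exact mul_le_mul_of_nonneg_left (hV a (Finset.ne_of_mem_erase ha))
      (Finset.prod_nonneg fun _ _ => norm_nonneg _)

end Expansion

section InverseSet

theorem one_le_log_natCast {p : ℕ} (hp : 3 ≤ p) : 1 ≤ Real.log p := by
  rw [Real.le_log_iff_exp_le (by positivity)]
  have : (3 : ℝ) ≤ p := by exact_mod_cast hp
  linarith [Real.exp_one_lt_d9]

variable {p : ℕ} [Fact p.Prime]

open scoped Classical in
/-- The set of `n < p` for which `f n` is invertible modulo `p` with inverse in
`{r, …, r + s - 1}`. -/
noncomputable def inverseSet (f : (ZMod p)[X]) (r : ℤ) (s : ℕ) : Finset ℕ :=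
  (Finset.range p).filter (fun n => f.eval (n : ZMod p) ≠ 0 ∧ ∃ h : ℤ, r ≤ h ∧ h < r + s ∧
    (h : ZMod p) * f.eval (n : ZMod p) = 1)

variable {f : (ZMod p)[X]} {r : ℤ} {s : ℕ}

theorem card_inverseSet_le : (inverseSet f r s).card ≤ p := by
  classical
  exact (Finset.card_filter_le _ _).trans (Finset.card_range p).le

theorem mem_inverseSet_iff {n : ℕ} :
    n ∈ inverseSet f r s ↔ n < p ∧ f.eval (n : ZMod p) ≠ 0 ∧ ∃ h : ℤ, r ≤ h ∧ h < r + s ∧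
      (h : ZMod p) * f.eval (n : ZMod p) = 1 := by
  classical
  rw [inverseSet, Finset.mem_filter, Finset.mem_range]

theorem card_filter_univ_eq_card_inverseSet
    [DecidablePred fun x : ZMod p => f.eval x ≠ 0 ∧ ∃ h : ℤ, r ≤ h ∧ h < r + s ∧
      (h : ZMod p) * f.eval x = 1] :
    (Finset.univ.filter fun x : ZMod p => f.eval x ≠ 0 ∧ ∃ h : ℤ, r ≤ h ∧ h < r + s ∧
      (h : ZMod p) * f.eval x = 1).card = (inverseSet f r s).card := by
  refine Finset.card_nbij' (fun x => x.val) (fun n => (n : ZMod p)) ?_ ?_ ?_ ?_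
  · intro x hx
    have hx := (Finset.mem_filter.1 (Finset.mem_coe.1 hx)).2
    refine Finset.mem_coe.2 (mem_inverseSet_iff.2 ⟨x.val_lt, ?_⟩)
    rwa [ZMod.natCast_zmod_val]
  · intro n hn
    exact Finset.mem_coe.2 (Finset.mem_filter.2
      ⟨Finset.mem_univ _, (mem_inverseSet_iff.1 (Finset.mem_coe.1 hn)).2⟩)
  · intro x _
    exact ZMod.natCast_zmod_val x
  · intro n hn
    exact ZMod.val_cast_of_lt (mem_inverseSet_iff.1 (Finset.mem_coe.1 hn)).1

theorem val_mem_inverseSet_iff {x : ZMod p} (hx : f.eval x ≠ 0) :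
    x.val ∈ inverseSet f r s ↔ ∃ h : ℤ, r ≤ h ∧ h < r + s ∧ (h : ZMod p) = (f.eval x)⁻¹ := by
  rw [mem_inverseSet_iff, ZMod.natCast_zmod_val]
  simp only [← mul_inv_eq_one₀ (inv_ne_zero hx), inv_inv]
  exact ⟨fun h => h.2.2, fun h => ⟨x.val_lt, hx, h⟩⟩

theorem fsub_inverseSet_natCast (n : ℕ) :
    fsub p (inverseSet f r s) (n : ZMod p).val = fsub p (inverseSet f r s) n := by
  rw [fsub, fsub, ZMod.val_natCast, Nat.mod_mod]

theorem abs_fsub_inverseSet_le (n : ℕ) : |fsub p (inverseSet f r s) n| ≤ 1 := by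
  have hp : (0 : ℝ) < p := Nat.cast_pos.2 (Fact.out : p.Prime).pos
  have h0 : 0 ≤ ((inverseSet f r s).card : ℝ) / p := by positivity
  have h1 : ((inverseSet f r s).card : ℝ) / p ≤ 1 :=
    (div_le_one hp).2 (Nat.cast_le.2 card_inverseSet_le)
  rw [fsub, abs_le]
  split_ifs <;> constructor <;> linarith

theorem card_eval_eq_zero_le (hf : f ≠ 0) (t : ZMod p) :
    (Finset.univ.filter fun x => f.eval (x + t) = 0).card ≤ f.natDegree := by
  classical
  have h1 : (Finset.univ.filter fun x => f.eval (x + t) = 0) ⊆ (taylor t f).roots.toFinset := by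
    intro x hx
    rw [Multiset.mem_toFinset, mem_roots ((taylor_eq_zero _ _).not.2 hf), IsRoot.def, taylor_eval]
    exact (Finset.mem_filter.1 hx).2
  refine (Finset.card_le_card h1).trans ((Multiset.toFinset_card_le _).trans ?_)
  exact (card_roots' _).trans (natDegree_taylor _ _).le

theorem one_le_sqrt_natCast : 1 ≤ √(p : ℝ) := by
  rw [Real.one_le_sqrt]
  exact_mod_cast (Fact.out : p.Prime).one_lt.le

/-- The size of `inverseSet f r s` is close to `s`. -/
theorem abs_card_inverseSet_sub_le (hp : 3 ≤ p) (hs : s < p) (hf : Squarefree f)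
    (hf1 : 1 ≤ f.natDegree) (hfp : f.natDegree < p) :
    |((inverseSet f r s).card : ℝ) - s| ≤ 7 * f.natDegree * √p * Real.log p := by
  classical
  have hp0 : (0 : ℝ) < p := Nat.cast_pos.2 (Fact.out : p.Prime).pos
  have hcard : ((inverseSet f r s).card : ℂ) = ∑ a, intervalCoeff p r s a *
      ∑ x with f.eval x ≠ 0, ZMod.stdAddChar (a / f.eval x) := by
    have h1 : ((inverseSet f r s).card : ℂ) = ∑ x : ZMod p with f.eval x ≠ 0,
        if ∃ h : ℤ, r ≤ h ∧ h < r + s ∧ (h : ZMod p) = (f.eval x)⁻¹ then (1 : ℂ) else 0 := by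
      rw [Finset.sum_boole, Finset.filter_filter, ← card_filter_univ_eq_card_inverseSet]
      congr 2
      refine Finset.filter_congr fun x _ => and_congr_right fun hx => ?_
      simp only [← mul_inv_eq_one₀ (inv_ne_zero hx), inv_inv]
    rw [h1]
    simp_rw [Finset.mul_sum]
    rw [Finset.sum_comm]
    refine Finset.sum_congr rfl fun x _ => ?_
    rw [← sum_intervalCoeff_mul r hs.le]
    simp_rw [div_eq_mul_inv]
  have hsum : ∀ a : ZMod p, a ≠ 0 →
      ‖∑ x with f.eval x ≠ 0, ZMod.stdAddChar (a / f.eval x)‖ ≤ 2 * f.natDegree * √p := by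
    intro a ha
    have := norm_sum_stdAddChar_le hp hf hf1 hfp
      (A := C a) ⟨C a⁻¹, 0, by rw [zero_mul, add_zero, ← C_mul, inv_mul_cancel₀ ha, C_1]⟩ (by simp)
    simpa only [eval_C] using this
  have hzero : ‖intervalCoeff p r s 0 *
      ∑ x with f.eval x ≠ 0, ZMod.stdAddChar (0 / f.eval x) - s‖ ≤ f.natDegree := by
    have h1 := card_eval_eq_zero_le hf.ne_zero 0
    have h2 := Finset.card_filter_add_card_filter_not (s := (Finset.univ : Finset (ZMod p)))
      (fun x => f.eval x = 0)
    rw [Finset.card_univ, ZMod.card] at h2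
    simp only [add_zero] at h1
    simp only [zero_div, AddChar.map_zero_eq_one, Finset.sum_const, nsmul_eq_mul, mul_one]
    rw [intervalCoeff_zero]
    have h3 : ((Finset.univ.filter fun x => f.eval x ≠ 0).card : ℂ) =
        p - (Finset.univ.filter fun x => f.eval x = 0).card := by
      rw [eq_sub_iff_add_eq']
      exact_mod_cast h2
    have hpc : (p : ℂ) ≠ 0 := by exact_mod_cast hp0.ne'
    rw [h3, show (s : ℂ) / p * (p - (Finset.univ.filter fun x => f.eval x = 0).card) - s =
      -(s / p * (Finset.univ.filter fun x => f.eval x = 0).card) by field_simp; ring, norm_neg,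
      norm_mul, norm_div, Complex.norm_natCast, Complex.norm_natCast, Complex.norm_natCast]
    have h4 : (s : ℝ) / p ≤ 1 := (div_le_one hp0).2 (by exact_mod_cast hs.le)
    calc _ ≤ 1 * (f.natDegree : ℝ) := by gcongr
      _ = _ := one_mul _
  have hlog := one_le_log_natCast hp
  have hsqrt := one_le_sqrt_natCast (p := p)
  rw [← Real.norm_eq_abs, ← Complex.norm_real]
  push_cast
  rw [hcard, ← Finset.add_sum_erase _ _ (Finset.mem_univ (0 : ZMod p)), add_sub_right_comm]
  have herase : Finset.univ.erase (0 : ZMod p) = Finset.univ.filter fun a => a ≠ 0 := by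
    ext; simp
  rw [herase]
  have hrest : ‖∑ a with a ≠ 0, intervalCoeff p r s a *
      ∑ x with f.eval x ≠ 0, ZMod.stdAddChar (a / f.eval x)‖ ≤
      (4 / 5 * Real.log p + 2) * (2 * f.natDegree * √p) := by
    refine (norm_sum_le _ _).trans ?_
    refine le_trans ?_ (mul_le_mul_of_nonneg_right (sum_norm_intervalCoeff_le r s)
      (by positivity))
    rw [Finset.sum_mul]
    refine Finset.sum_le_sum fun a ha => ?_
    rw [norm_mul]
    exact mul_le_mul_of_nonneg_left (hsum a (Finset.mem_filter.1 ha).2) (norm_nonneg _)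
  refine (norm_add_le _ _).trans ((add_le_add hzero hrest).trans ?_)
  have hD : (0 : ℝ) ≤ f.natDegree := Nat.cast_nonneg _
  have h1 : (f.natDegree : ℝ) ≤ f.natDegree * √p := le_mul_of_one_le_right hD hsqrt
  have h2 : (f.natDegree : ℝ) * √p ≤ f.natDegree * √p * Real.log p :=
    le_mul_of_one_le_right (by positivity) hlog
  linarith

/-- Fourier expansion of the balanced indicator function of `inverseSet f r s`. -/
theorem fsub_inverseSet_eq_sum (hs : s < p) {x : ZMod p} (hx : f.eval x ≠ 0) :
    (fsub p (inverseSet f r s) x.val : ℂ) =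
      ∑ a, (intervalCoeff p r s a - if a = 0 then ((inverseSet f r s).card : ℂ) / p else 0) *
        ZMod.stdAddChar (a * (f.eval x)⁻¹) := by
  classical
  simp_rw [sub_mul, Finset.sum_sub_distrib, sum_intervalCoeff_mul r hs.le, ite_mul, zero_mul]
  rw [Finset.sum_ite_eq' Finset.univ, if_pos (Finset.mem_univ _), zero_mul,
    AddChar.map_zero_eq_one, mul_one, fsub, Nat.mod_eq_of_lt x.val_lt,
    if_congr (val_mem_inverseSet_iff hx) rfl rfl]
  split_ifs <;> push_cast <;> ring

/-- The correlations of `inverseSet f r s`, with the number of shifts entering explicitly. -/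
theorem abs_sum_prod_fsub_inverseSet_le (hp : 3 ≤ p) (hs : s < p) (hf : Squarefree f)
    (hf1 : 1 ≤ f.natDegree) {k : ℕ} (hk : 0 < k) (hkp : 2 * f.natDegree * k < p) {M : ℕ}
    (hM : M ≤ p) {d : Fin k → ℕ} (hd : StrictMono d) (hdp : ∀ i, d i ≤ p - 1) :
    |∑ n ∈ Finset.range M, ∏ i, fsub p (inverseSet f r s) (n + d i)| ≤
      k * f.natDegree + 7 * f.natDegree * √p * Real.log p +
        (4 / 5 * Real.log p + 3) ^ (k + 1) * (3 * (k * f.natDegree) * √p) := by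
  classical
  have hp0 : (0 : ℝ) < p := Nat.cast_pos.2 (Fact.out : p.Prime).pos
  have hfp : f.natDegree < p := by nlinarith
  set R := inverseSet f r s with hR
  let e : Fin k → ZMod p := fun i => (d i : ZMod p)
  have he : Function.Injective e := by
    intro i j hij
    have h1 := hdp i
    have h2 := hdp j
    have h3 : ((d i : ℕ) : ZMod p) = (d j : ℕ) := hij
    rw [ZMod.natCast_eq_natCast_iff', Nat.mod_eq_of_lt (by omega),
      Nat.mod_eq_of_lt (by omega)] at h3
    exact hd.injective h3
  let F : ZMod p → ℝ := fun x => ∏ i, fsub p R (x + e i).val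
  have hF : ∑ n ∈ Finset.range M, ∏ i, fsub p R (n + d i) = ∑ x with x.val < M, F x := by
    refine Finset.sum_nbij' (fun n => (n : ZMod p)) (fun x => x.val) ?_ ?_ ?_ ?_ ?_
    · intro n hn
      rw [Finset.mem_range] at hn
      simp only [Finset.mem_filter, Finset.mem_univ, true_and]
      rwa [ZMod.val_natCast, Nat.mod_eq_of_lt (by omega)]
    · intro x hx
      exact Finset.mem_range.2 (Finset.mem_filter.1 hx).2
    · intro n hn
      rw [Finset.mem_range] at hn
      rw [ZMod.val_natCast, Nat.mod_eq_of_lt (by omega)]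
    · intro x _
      exact ZMod.natCast_zmod_val x
    · intro n _
      refine Finset.prod_congr rfl fun i _ => ?_
      rw [← fsub_inverseSet_natCast, Nat.cast_add]
  have hF1 : ∀ x, |F x| ≤ 1 := by
    intro x
    rw [Finset.abs_prod]
    exact Finset.prod_le_one (fun _ _ => abs_nonneg _) fun _ _ => abs_fsub_inverseSet_le _
  let T : Finset (ZMod p) := Finset.univ.filter fun x => ∀ i, f.eval (x + e i) ≠ 0
  let T' : Finset (ZMod p) := T.filter fun x => x.val < M
  have hsplit : ∑ x with x.val < M, F x = ∑ x ∈ T', F x +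
      ∑ x ∈ (Finset.univ.filter fun x : ZMod p => x.val < M) with
        ¬ ∀ i, f.eval (x + e i) ≠ 0, F x := by
    rw [← Finset.sum_filter_add_sum_filter_not _ fun x => ∀ i, f.eval (x + e i) ≠ 0]
    congr 2
    rw [Finset.filter_comm]
  have hbad : |∑ x ∈ (Finset.univ.filter fun x : ZMod p => x.val < M) with
        ¬ ∀ i, f.eval (x + e i) ≠ 0, F x| ≤ k * f.natDegree := by
    refine (Finset.abs_sum_le_sum_abs _ _).trans ((Finset.sum_le_sum fun x _ => hF1 x).trans ?_)
    rw [Finset.sum_const, nsmul_eq_mul, mul_one]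
    have h1 : ((Finset.univ.filter fun x : ZMod p => x.val < M).filter fun x =>
        ¬ ∀ i, f.eval (x + e i) ≠ 0) ⊆
        Finset.univ.biUnion fun i => Finset.univ.filter fun x => f.eval (x + e i) = 0 := by
      intro x hx
      have h2 := (Finset.mem_filter.1 hx).2
      push Not at h2
      simpa using h2
    have h2 := (Finset.card_le_card h1).trans Finset.card_biUnion_le
    have h3 := h2.trans (Finset.sum_le_sum fun i _ => card_eval_eq_zero_le hf.ne_zero (e i))
    rw [Finset.sum_const, Finset.card_univ, Fintype.card_fin, smul_eq_mul] at h3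
    exact_mod_cast h3
  let κ : ZMod p → ℂ := fun a =>
    intervalCoeff p r s a - if a = 0 then (R.card : ℂ) / p else 0
  have hcard := abs_card_inverseSet_sub_le (r := r) hp hs hf hf1 hfp
  rw [← hR] at hcard
  have hκ0 : ‖κ 0‖ = |(R.card : ℝ) - s| / p := by
    have h1 : κ 0 = ((((s : ℝ) - R.card) / p : ℝ) : ℂ) := by
      simp only [κ, intervalCoeff_zero, if_true]
      push_cast
      ring
    rw [h1, Complex.norm_real, Real.norm_eq_abs, abs_div, abs_sub_comm, abs_of_pos hp0]
  have hκ1 : ‖κ 0‖ ≤ 1 := by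
    have h1 : (R.card : ℝ) ≤ p := by exact_mod_cast card_inverseSet_le
    have h2 : (s : ℝ) ≤ p := by exact_mod_cast hs.le
    have h3 : (0 : ℝ) ≤ R.card := Nat.cast_nonneg _
    have h4 : (0 : ℝ) ≤ s := Nat.cast_nonneg _
    rw [hκ0, div_le_one hp0, abs_le]
    constructor <;> linarith
  have hκL : ∑ a with a ≠ 0, ‖κ a‖ ≤ 4 / 5 * Real.log p + 2 := by
    refine le_trans (le_of_eq (Finset.sum_congr rfl fun a ha => ?_))
      (sum_norm_intervalCoeff_le r s)
    simp only [κ]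
    rw [if_neg (Finset.mem_filter.1 ha).2, sub_zero]
  set L := Real.log p
  have hL : 0 ≤ L := Real.log_natCast_nonneg p
  have hV : ∀ a : Fin k → ZMod p, a ≠ 0 →
      ‖∑ x ∈ T', ZMod.stdAddChar (∑ i, a i * (f.eval (x + e i))⁻¹)‖ ≤
        (4 / 5 * L + 3) * (3 * (k * f.natDegree) * √p) := fun a ha =>
    norm_sum_val_lt_le T _ hM fun b =>
      norm_sum_stdAddChar_translates_le hp hf hf1 he hkp ha b
  have hmain := norm_sum_prod_le hk T' (fun i x => (f.eval (x + e i))⁻¹) hκ1 hκL hV (by positivity)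
  have hgood : |∑ x ∈ T', F x| ≤ 7 * f.natDegree * √p * L +
      (4 / 5 * L + 3) ^ (k + 1) * (3 * (k * f.natDegree) * √p) := by
    rw [← Real.norm_eq_abs, ← Complex.norm_real]
    have h1 : ((∑ x ∈ T', F x : ℝ) : ℂ) =
        ∑ x ∈ T', ∏ i, ∑ a, κ a * ZMod.stdAddChar (a * (f.eval (x + e i))⁻¹) := by
      push_cast
      refine Finset.sum_congr rfl fun x hx => ?_
      simp only [F]
      push_cast
      refine Finset.prod_congr rfl fun i _ => ?_
      exact fsub_inverseSet_eq_sum hs ((Finset.mem_filter.1 (Finset.mem_filter.1 hx).1).2 i)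
    rw [h1]
    refine hmain.trans (add_le_add ?_ (le_of_eq ?_))
    · have h2 : (T'.card : ℝ) ≤ p := by
        have := Finset.card_le_univ T'
        rw [ZMod.card] at this
        exact_mod_cast this
      rw [hκ0]
      calc _ ≤ |(R.card : ℝ) - s| / p * p := by gcongr
        _ = |(R.card : ℝ) - s| := div_mul_cancel₀ _ hp0.ne'
        _ ≤ _ := hcard
    · rw [add_assoc, show (2 : ℝ) + 1 = 3 by norm_num]
      ring
  rw [hF, hsplit]
  refine (abs_add_le _ _).trans ?_
  linarith

/-- The correlation measure of `inverseSet f r s`. -/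
theorem corrK_inverseSet_le (hp : 3 ≤ p) (hs : s < p) (hf : Squarefree f)
    (hf1 : 1 ≤ f.natDegree) {k : ℕ} (hk : 0 < k) (hkp : 2 * f.natDegree * k < p) :
    corrK (inverseSet f r s) p k ≤
      (Real.exp 30 + 38) * f.natDegree * √p * Real.log p ^ (k + 1) := by
  have hp0 : (0 : ℝ) < p := Nat.cast_pos.2 (Fact.out : p.Prime).pos
  have hlog := one_le_log_natCast hp
  have hsqrt := one_le_sqrt_natCast (p := p)
  have hD : (1 : ℝ) ≤ f.natDegree := by exact_mod_cast hf1
  have hexp := Real.exp_pos 30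
  set L := Real.log p with hL
  have hY1 : 1 ≤ f.natDegree * √p := one_le_mul_of_one_le_of_one_le hD hsqrt
  set Y := f.natDegree * √p with hY
  have hLk : 1 ≤ L ^ (k + 1) := one_le_pow₀ hlog
  have hLk' : L ≤ L ^ (k + 1) := le_self_pow₀ hlog (by omega)
  rw [corrK]
  refine Real.sSup_le ?_ (by positivity)
  rintro _ ⟨M, d, _, hM, hd, hdp, rfl⟩
  rw [mul_assoc (Real.exp 30 + 38), ← hY]
  rcases le_total 30 L with h30 | h30
  · refine (abs_sum_prod_fsub_inverseSet_le hp hs hf hf1 hk hkp hM hd hdp).trans ?_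
    rw [← hL]
    have hk9 : (k : ℝ) * (9 / 10) ^ (k + 1) ≤ 9 := by
      have h1 := one_add_mul_le_pow (a := (1 / 9 : ℝ)) (by norm_num) (k + 1)
      have h2 : ((1 : ℝ) + 1 / 9) ^ (k + 1) * (9 / 10) ^ (k + 1) = 1 := by
        rw [← mul_pow]; norm_num
      have h3 : (0 : ℝ) < (9 / 10) ^ (k + 1) := by positivity
      push_cast at h1
      nlinarith
    have hpow : (4 / 5 * L + 3) ^ (k + 1) ≤ (9 / 10) ^ (k + 1) * L ^ (k + 1) := by
      rw [← mul_pow]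
      exact pow_le_pow_left₀ (by linarith) (by linarith) _
    have hkL : (k : ℝ) ≤ L ^ (k + 1) := by
      have h1 : (k : ℝ) ≤ 2 ^ (k + 1) := by
        have := (Nat.lt_two_pow_self (n := k + 1)).le
        exact_mod_cast (Nat.le_succ k).trans this
      exact h1.trans (pow_le_pow_left₀ (by norm_num) (by linarith) _)
    have e1 : (k : ℝ) * f.natDegree ≤ L ^ (k + 1) * Y := by
      refine mul_le_mul hkL (le_mul_of_one_le_right (by positivity) hsqrt) (by positivity)
        (by positivity)
    have e2 : 7 * f.natDegree * √p * L ≤ 7 * (Y * L ^ (k + 1)) := by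
      have : Y * L ≤ Y * L ^ (k + 1) := mul_le_mul_of_nonneg_left hLk' (by positivity)
      rw [hY] at this ⊢
      linarith
    have e3 : (4 / 5 * L + 3) ^ (k + 1) * (3 * (k * f.natDegree) * √p) ≤
        27 * (Y * L ^ (k + 1)) := by
      calc _ ≤ (9 / 10) ^ (k + 1) * L ^ (k + 1) * (3 * (k * f.natDegree) * √p) := by gcongr
        _ = (k * (9 / 10) ^ (k + 1)) * (3 * (Y * L ^ (k + 1))) := by rw [hY]; ring
        _ ≤ 9 * (3 * (Y * L ^ (k + 1))) := by gcongr
        _ = _ := by ring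
    have e4 : 0 ≤ Real.exp 30 * (Y * L ^ (k + 1)) := by positivity
    have e5 : 0 ≤ Y * L ^ (k + 1) := by positivity
    linarith
  · have hpe : (p : ℝ) ≤ Real.exp 30 := (Real.log_le_iff_le_exp hp0).1 h30
    have h1 : |∑ n ∈ Finset.range M, ∏ i, fsub p (inverseSet f r s) (n + d i)| ≤ p := by
      refine (Finset.abs_sum_le_sum_abs _ _).trans ?_
      refine (Finset.sum_le_sum (g := fun _ => (1 : ℝ)) fun n _ => ?_).trans ?_
      · rw [Finset.abs_prod]
        exact Finset.prod_le_one (fun _ _ => abs_nonneg _) fun _ _ => abs_fsub_inverseSet_le _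
      · rw [Finset.sum_const, nsmul_eq_mul, mul_one, Finset.card_range]
        exact_mod_cast hM
    have h2 : 1 ≤ Y * L ^ (k + 1) := one_le_mul_of_one_le_of_one_le hY1 hLk
    nlinarith

end InverseSet

end

open scoped Classical in
theorem statement17 :
    ∃ c > (0 : ℝ), ∀ p : ℕ, p.Prime → Odd p →
      ∀ r : ℤ, ∀ s : ℕ, 0 < s → s < p →
      ∀ f : Polynomial (ZMod p), Squarefree f → 1 ≤ f.natDegree → f.natDegree < p →
      (|(((Finset.range p).filter
            (fun n => f.eval (n : ZMod p) ≠ 0 ∧ ∃ h : ℤ, r ≤ h ∧ h < r + s ∧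
              (h : ZMod p) * f.eval (n : ZMod p) = 1)).card : ℝ) - s| ≤
          c * f.natDegree * Real.sqrt p * Real.log p) ∧
      (∀ k : ℕ, 0 < k → 2 * f.natDegree * k < p →
        corrK ((Finset.range p).filter
            (fun n => f.eval (n : ZMod p) ≠ 0 ∧ ∃ h : ℤ, r ≤ h ∧ h < r + s ∧
              (h : ZMod p) * f.eval (n : ZMod p) = 1)) p k ≤
          c * f.natDegree * Real.sqrt p * Real.log p ^ (k + 1)) := by
  refine ⟨Real.exp 30 + 38, by positivity, fun p hpp hodd r s _ hs f hf hf1 hfp => ?_⟩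
  have : Fact p.Prime := ⟨hpp⟩
  have hp : 3 ≤ p := by
    have := hpp.two_le
    obtain ⟨m, hm⟩ := hodd
    omega
  refine ⟨?_, fun k hk hkp => corrK_inverseSet_le hp hs hf hf1 hk hkp⟩
  have huniv : (do let n ← Finset.range p; pure (n : ZMod p)) = Finset.univ := by
    refine Finset.eq_univ_of_forall fun x => ?_
    refine (@Finset.mem_sup _ _ (Classical.decEq _) _ _ _).2 ⟨x.val, Finset.mem_range.2 x.val_lt, ?_⟩
    exact Finset.mem_singleton.2 (ZMod.natCast_zmod_val x).symm
  rw [huniv, card_filter_univ_eq_card_inverseSet]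
  refine (abs_card_inverseSet_sub_le (r := r) hp hs hf hf1 hfp).trans ?_
  have hlog := one_le_log_natCast hp
  have hexp := Real.exp_pos 30
  gcongr
  linarith
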